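/- arXiv:2109.09009 — 7 statements merged into one kernel-verified Lean document; each statement's English description precedes it below -/
import Mathlib

section
/- Mean square stability of the stochastic theta method for the fractional linear test equation, large θ: Assume H ∈ (1/2,1), Δt > 0, κ ≥ 2H, λ, μ ∈ ℝ satisfy Condition (C), and θ ∈ [√(3/2)·e/(√(3/2)·e + 1), 1]. Let (V_n)_{n≥0} be a sequence of fBm increments with Hurst parameter H and step Δt, let X_0 be a nonzero real constant, and define recursively X_{n+1} = (α_n + β_n V_n)·X_n. Then lim_{n→∞} E[X_n²] = 0, i.e. the STM is mean square stable. -/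
open MeasureTheory ProbabilityTheory Filter Real

/-- Covariance of the increments of a fractional Brownian motion with Hurst
parameter `H` over a grid of step `Δt`. -/
noncomputable def fBmCov (H Δt : ℝ) (i j : ℕ) : ℝ :=
  Δt ^ (2 * H) / 2 *
    (|(i : ℝ) - j + 1| ^ (2 * H) + |(i : ℝ) - j - 1| ^ (2 * H)
      - 2 * |(i : ℝ) - j| ^ (2 * H))

/-- `(V n)` is a sequence of fBm increments with Hurst parameter `H` and step `Δt`:
each finite initial segment is a centered Gaussian vector with the fBm increment
covariances, expressed by the fact that every linear combination is a centered
real Gaussian with the corresponding variance. -/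
def IsfBmIncrements {Ω : Type*} [MeasurableSpace Ω] (P : Measure Ω) (H Δt : ℝ)
    (V : ℕ → Ω → ℝ) : Prop :=
  (∀ n, Measurable (V n)) ∧
    ∀ (n : ℕ) (c : ℕ → ℝ),
      P.map (fun ω => ∑ i ∈ Finset.range n, c i * V i ω)
        = gaussianReal 0
            (Real.toNNReal (∑ i ∈ Finset.range n, ∑ j ∈ Finset.range n,
              c i * c j * fBmCov H Δt i j))

/-- Coefficient `α_n` of the stochastic theta method for the linear test equation. -/
noncomputable def stmAlpha (θ lam κ Δt : ℝ) (n : ℕ) : ℝ :=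
  (1 - κ * (1 - θ) * lam * (n : ℝ) ^ (κ - 1) * Δt ^ κ)
    / (1 + κ * θ * lam * ((n : ℝ) + 1) ^ (κ - 1) * Δt ^ κ)

/-- Coefficient `β_n` of the stochastic theta method for the linear test equation. -/
noncomputable def stmBeta (θ lam μ κ Δt : ℝ) (n : ℕ) : ℝ :=
  μ / (1 + κ * θ * lam * ((n : ℝ) + 1) ^ (κ - 1) * Δt ^ κ)

/-- The increments of a fractional Brownian motion with `1/2 ≤ H` are positively correlated. -/
lemma fBmCov_nonneg {H Δt : ℝ} (hH : 1 / 2 ≤ H) (hΔt : 0 ≤ Δt) (i j : ℕ) :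
    0 ≤ fBmCov H Δt i j := by
  have key : ∀ d : ℝ, 2 * |d| ^ (2 * H) ≤ |d + 1| ^ (2 * H) + |d - 1| ^ (2 * H) := by
    intro d
    have hconv := (convexOn_rpow (show 1 ≤ 2 * H by linarith)).2
      (Set.mem_Ici.2 (abs_nonneg (d + 1))) (Set.mem_Ici.2 (abs_nonneg (d - 1)))
      (show (0 : ℝ) ≤ 1 / 2 by norm_num) (show (0 : ℝ) ≤ 1 / 2 by norm_num) (by norm_num)
    have habs : |d| ≤ 1 / 2 * |d + 1| + 1 / 2 * |d - 1| := by
      have h := abs_add_le (d + 1) (d - 1)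
      rw [show d + 1 + (d - 1) = 2 * d by ring, abs_mul, abs_two] at h
      linarith
    have hmono := rpow_le_rpow (abs_nonneg d) habs (show 0 ≤ 2 * H by linarith)
    simp only [smul_eq_mul] at hconv
    linarith
  have hd := key ((i : ℝ) - j)
  unfold fBmCov
  exact mul_nonneg (by positivity) (by linarith)

lemma fBmCov_comm (H Δt : ℝ) (i j : ℕ) : fBmCov H Δt i j = fBmCov H Δt j i := by
  unfold fBmCov
  rw [show (i : ℝ) - j + 1 = -((j : ℝ) - i - 1) by ring,
    show (i : ℝ) - j - 1 = -((j : ℝ) - i + 1) by ring,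
    show (i : ℝ) - j = -((j : ℝ) - i) by ring, abs_neg, abs_neg, abs_neg]
  ring

lemma rpow_sub_rpow_sub_one_le {p x : ℝ} (hp : 1 ≤ p) (hx : 1 ≤ x) :
    x ^ p - (x - 1) ^ p ≤ p * x ^ (p - 1) := by
  have hx0 : 0 < x := by linarith
  have hinv : x⁻¹ ≤ 1 := inv_le_one_of_one_le₀ hx
  have h := one_add_mul_self_le_rpow_one_add (s := -x⁻¹) (by linarith) hp
  have hmul : x - 1 = x * (1 + -x⁻¹) := by field_simp; ring
  have hpow : x ^ p = x * x ^ (p - 1) := by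
    rw [← rpow_one_add' hx0.le (by linarith)]; ring_nf
  rw [hmul, mul_rpow hx0.le (by linarith)]
  have h2 := mul_le_mul_of_nonneg_left h (rpow_nonneg hx0.le p)
  have h3 : x ^ p * (p * x⁻¹) = p * x ^ (p - 1) := by
    rw [hpow]; field_simp
  linarith

lemma mul_rpow_neg_le_rpow_sub {t x : ℝ} (ht0 : 0 ≤ t) (ht1 : t < 1) (hx : 1 ≤ x) :
    (1 - t) * x ^ (-t) ≤ x ^ (1 - t) - (x - 1) ^ (1 - t) := by
  have hx0 : 0 < x := by linarith
  have hinv : x⁻¹ ≤ 1 := inv_le_one_of_one_le₀ hx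
  have h := rpow_one_add_le_one_add_mul_self (s := -x⁻¹) (by linarith)
    (p := 1 - t) (by linarith) (by linarith)
  have hmul : x - 1 = x * (1 + -x⁻¹) := by field_simp; ring
  have hpow : x ^ (1 - t) = x * x ^ (-t) := by
    rw [← rpow_one_add' hx0.le (by linarith)]; ring_nf
  rw [hmul, mul_rpow hx0.le (by linarith)]
  have h2 := mul_le_mul_of_nonneg_left h (rpow_nonneg hx0.le (1 - t))
  have h3 : x ^ (1 - t) * ((1 - t) * x⁻¹) = (1 - t) * x ^ (-t) := by
    rw [hpow]; field_simp
  linarith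

lemma sum_range_rpow_neg_le {t : ℝ} (ht0 : 0 ≤ t) (ht1 : t < 1) (n : ℕ) :
    ∑ i ∈ Finset.range n, ((i : ℝ) + 1) ^ (-t) ≤ (n : ℝ) ^ (1 - t) / (1 - t) := by
  rw [le_div_iff₀ (by linarith)]
  induction n with
  | zero => simp [zero_rpow (show 1 - t ≠ 0 by linarith)]
  | succ n ih =>
    rw [Finset.sum_range_succ]
    have h := mul_rpow_neg_le_rpow_sub ht0 ht1 (show (1 : ℝ) ≤ (n : ℝ) + 1 by simp)
    rw [add_sub_cancel_right] at h
    push_cast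
    linarith

lemma sum_range_fBmCov_le {H Δt : ℝ} (hH : 1 / 2 ≤ H) (hΔt : 0 ≤ Δt) {i n : ℕ} (hi : i < n) :
    ∑ j ∈ Finset.range n, fBmCov H Δt i j
      ≤ 2 * H * Δt ^ (2 * H) * (n : ℝ) ^ (2 * H - 1) := by
  set h : ℕ → ℝ := fun j => |(i : ℝ) - j + 1| ^ (2 * H) - |(i : ℝ) - j| ^ (2 * H) with hh
  have hterm : ∀ j ∈ Finset.range n,
      fBmCov H Δt i j = Δt ^ (2 * H) / 2 * (h j - h (j + 1)) := by
    intro j _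
    simp only [hh, fBmCov]
    push_cast
    rw [show (i : ℝ) - (j + 1) + 1 = i - j by ring,
      show (i : ℝ) - (j + 1) = i - j - 1 by ring]
    ring
  rw [Finset.sum_congr rfl hterm, ← Finset.mul_sum, Finset.sum_range_sub']
  have hin : (i : ℝ) + 1 ≤ n := by exact_mod_cast hi
  have hi0 : (0 : ℝ) ≤ i := by positivity
  have hstep : ∀ x : ℝ, 1 ≤ x → x ≤ n →
      x ^ (2 * H) - (x - 1) ^ (2 * H) ≤ 2 * H * (n : ℝ) ^ (2 * H - 1) := by
    intro x hx hxn
    refine (rpow_sub_rpow_sub_one_le (by linarith) hx).trans ?_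
    have := rpow_le_rpow (by linarith) hxn (show 0 ≤ 2 * H - 1 by linarith)
    exact mul_le_mul_of_nonneg_left this (by linarith)
  have hfirst := hstep ((i : ℝ) + 1) (by linarith) hin
  have hlast := hstep ((n : ℝ) - i) (by linarith) (by linarith)
  have h0 : h 0 = ((i : ℝ) + 1) ^ (2 * H) - ((i : ℝ) + 1 - 1) ^ (2 * H) := by
    simp only [hh, Nat.cast_zero, sub_zero, add_sub_cancel_right]
    rw [abs_of_nonneg (by linarith), abs_of_nonneg hi0]
  have hn : h n = ((n : ℝ) - i - 1) ^ (2 * H) - ((n : ℝ) - i) ^ (2 * H) := by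
    simp only [hh]
    rw [abs_of_nonpos (show (i : ℝ) - n + 1 ≤ 0 by linarith),
      abs_of_nonpos (show (i : ℝ) - n ≤ 0 by linarith)]
    ring_nf
  have hle : h 0 - h n ≤ 2 * (2 * H * (n : ℝ) ^ (2 * H - 1)) := by rw [h0, hn]; linarith
  have := mul_le_mul_of_nonneg_left hle (show 0 ≤ Δt ^ (2 * H) / 2 by positivity)
  linarith

/-- Schur-type bound for a quadratic form with the covariances of fBm increments. -/
lemma sum_sum_mul_fBmCov_le {H Δt : ℝ} (hH : 1 / 2 ≤ H) (hΔt : 0 ≤ Δt) (b : ℕ → ℝ) (n : ℕ) :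
    ∑ i ∈ Finset.range n, ∑ j ∈ Finset.range n, b i * b j * fBmCov H Δt i j
      ≤ 2 * H * Δt ^ (2 * H) * (n : ℝ) ^ (2 * H - 1) * ∑ i ∈ Finset.range n, b i ^ 2 := by
  have hswap : ∑ i ∈ Finset.range n, ∑ j ∈ Finset.range n, b j ^ 2 * fBmCov H Δt i j
      = ∑ i ∈ Finset.range n, ∑ j ∈ Finset.range n, b i ^ 2 * fBmCov H Δt i j := by
    rw [Finset.sum_comm]
    refine Finset.sum_congr rfl fun i _ => Finset.sum_congr rfl fun j _ => ?_
    rw [fBmCov_comm]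
  have hle : ∑ i ∈ Finset.range n, ∑ j ∈ Finset.range n, b i * b j * fBmCov H Δt i j
      ≤ ∑ i ∈ Finset.range n, ∑ j ∈ Finset.range n,
        (b i ^ 2 * fBmCov H Δt i j + b j ^ 2 * fBmCov H Δt i j) / 2 := by
    refine Finset.sum_le_sum fun i _ => Finset.sum_le_sum fun j _ => ?_
    have := mul_nonneg (sq_nonneg (b i - b j)) (fBmCov_nonneg hH hΔt i j)
    linarith
  refine hle.trans ?_
  simp only [← Finset.sum_div, Finset.sum_add_distrib]
  rw [hswap, add_self_div_two, Finset.mul_sum]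
  refine Finset.sum_le_sum fun i hi => ?_
  rw [← Finset.mul_sum, mul_comm]
  exact mul_le_mul_of_nonneg_right
    (sum_range_fBmCov_le hH hΔt (Finset.mem_range.1 hi)) (sq_nonneg _)

lemma IsfBmIncrements.integrable_exp_sum {Ω : Type*} [MeasurableSpace Ω] {P : Measure Ω}
    {H Δt : ℝ} {V : ℕ → Ω → ℝ} (hV : IsfBmIncrements P H Δt V) (n : ℕ) (c : ℕ → ℝ) :
    Integrable (fun ω => exp (∑ i ∈ Finset.range n, c i * V i ω)) P := by
  have hmeas : Measurable (fun ω => ∑ i ∈ Finset.range n, c i * V i ω) :=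
    Finset.measurable_sum _ fun i _ => (hV.1 i).const_mul _
  have h := integrable_exp_mul_gaussianReal (μ := 0)
    (v := Real.toNNReal (∑ i ∈ Finset.range n, ∑ j ∈ Finset.range n,
              c i * c j * fBmCov H Δt i j)) 1
  rw [← hV.2 n c] at h
  simpa [Function.comp_def] using h.comp_measurable hmeas

lemma IsfBmIncrements.integral_exp_sum_le {Ω : Type*} [MeasurableSpace Ω] {P : Measure Ω}
    {H Δt : ℝ} (hH : 1 / 2 ≤ H) (hΔt : 0 ≤ Δt) {V : ℕ → Ω → ℝ}
    (hV : IsfBmIncrements P H Δt V) {b c : ℕ → ℝ} (hbc : ∀ i, |c i| ≤ b i) (n : ℕ) :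
    ∫ ω, exp (∑ i ∈ Finset.range n, c i * V i ω) ∂P
      ≤ exp ((∑ i ∈ Finset.range n, ∑ j ∈ Finset.range n,
          b i * b j * fBmCov H Δt i j) / 2) := by
  have h := mgf_gaussianReal (hV.2 n c) 1
  simp only [mgf, one_mul, zero_add, one_pow, mul_one] at h
  rw [h, exp_le_exp, Real.coe_toNNReal']
  have hb : ∀ i, 0 ≤ b i := fun i => (abs_nonneg _).trans (hbc i)
  have hcov := fBmCov_nonneg hH hΔt
  gcongr
  refine max_le (Finset.sum_le_sum fun i _ => Finset.sum_le_sum fun j _ => ?_) ?_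
  · refine mul_le_mul_of_nonneg_right ?_ (hcov i j)
    refine (le_abs_self _).trans ?_
    rw [abs_mul]
    exact mul_le_mul (hbc i) (hbc j) (abs_nonneg _) (hb i)
  · exact Finset.sum_nonneg fun i _ => Finset.sum_nonneg fun j _ =>
      mul_nonneg (mul_nonneg (hb i) (hb j)) (hcov i j)

lemma prod_exp_add_exp_neg (n : ℕ) (c v : ℕ → ℝ) :
    ∏ i ∈ Finset.range n, (exp (c i * v i) + exp (-(c i * v i)))
      = ∑ t ∈ (Finset.range n).powerset,
        exp (∑ i ∈ Finset.range n, (if i ∈ t then c i else -c i) * v i) := by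
  rw [Finset.prod_add]
  refine Finset.sum_congr rfl fun t ht => ?_
  rw [← exp_sum, ← exp_sum, ← exp_add, ← Finset.sum_sdiff (Finset.mem_powerset.1 ht), add_comm]
  congr 2
  · refine Finset.sum_congr rfl fun i hi => ?_
    rw [if_neg (Finset.mem_sdiff.1 hi).2, neg_mul]
  · refine Finset.sum_congr rfl fun i hi => ?_
    rw [if_pos hi]

lemma IsfBmIncrements.integrable_prod_exp_add_exp_neg {Ω : Type*} [MeasurableSpace Ω]
    {P : Measure Ω} {H Δt : ℝ} {V : ℕ → Ω → ℝ} (hV : IsfBmIncrements P H Δt V)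
    (n : ℕ) (c : ℕ → ℝ) :
    Integrable (fun ω => ∏ i ∈ Finset.range n,
      (exp (c i * V i ω) + exp (-(c i * V i ω)))) P := by
  simp only [prod_exp_add_exp_neg n c (fun i => V i _)]
  exact integrable_finsetSum _ fun t _ => hV.integrable_exp_sum n _

lemma IsfBmIncrements.integral_prod_exp_add_exp_neg_le {Ω : Type*} [MeasurableSpace Ω]
    {P : Measure Ω} {H Δt : ℝ} (hH : 1 / 2 ≤ H) (hΔt : 0 ≤ Δt) {V : ℕ → Ω → ℝ}
    (hV : IsfBmIncrements P H Δt V) {b c : ℕ → ℝ} (hbc : ∀ i, |c i| ≤ b i) (n : ℕ) :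
    ∫ ω, ∏ i ∈ Finset.range n, (exp (c i * V i ω) + exp (-(c i * V i ω))) ∂P
      ≤ 2 ^ n * exp ((∑ i ∈ Finset.range n, ∑ j ∈ Finset.range n,
          b i * b j * fBmCov H Δt i j) / 2) := by
  simp only [prod_exp_add_exp_neg n c (fun i => V i _)]
  rw [integral_finsetSum _ fun t _ => hV.integrable_exp_sum n _]
  refine (Finset.sum_le_card_nsmul _ _ _ fun t _ =>
    hV.integral_exp_sum_le hH hΔt (b := b) (fun i => ?_) n).trans ?_
  · split_ifs
    · exact hbc i
    · rw [abs_neg]; exact hbc i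
  · simp [Finset.card_powerset]

lemma sq_add_le_sq_mul_exp_add_exp_neg {α x r : ℝ} (hr : 0 < r) (hα : |α| ≤ r) :
    (α + x) ^ 2 ≤ r ^ 2 * (exp (2 * x / r) + exp (-(2 * x / r))) := by
  set y := x / r with hy
  have hx : x = r * y := by rw [hy]; field_simp
  have h1 : |α + x| ≤ r * exp |y| := by
    refine (abs_add_le _ _).trans ?_
    rw [hx, abs_mul, abs_of_pos hr]
    nlinarith [add_one_le_exp |y|]
  have h2 : exp |y| ^ 2 = exp |2 * y| := by
    rw [← exp_nat_mul, abs_mul, abs_two]; norm_num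
  have h3 : exp |2 * y| ≤ exp (2 * y) + exp (-(2 * y)) := exp_abs_le _
  rw [show 2 * x / r = 2 * y by rw [hy]; ring]
  calc (α + x) ^ 2 = |α + x| ^ 2 := (sq_abs _).symm
    _ ≤ (r * exp |y|) ^ 2 := by gcongr
    _ = r ^ 2 * exp |2 * y| := by rw [mul_pow, h2]
    _ ≤ _ := by gcongr

lemma three_div_four_le_of_sqrt_mul_exp_le {θ : ℝ}
    (hθ : √(3 / 2) * exp 1 / (√(3 / 2) * exp 1 + 1) ≤ θ) : 3 / 4 ≤ θ := by
  refine le_trans ?_ hθ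
  have hs : (1.2 : ℝ) ≤ √(3 / 2) := le_sqrt_of_sq_le (by norm_num)
  have he := exp_one_gt_d9
  have h3 : 3 ≤ √(3 / 2) * exp 1 := by nlinarith
  rw [div_le_div_iff₀ (by norm_num) (by linarith)]
  linarith

lemma eventually_abs_stmAlpha_le {θ lam κ Δt : ℝ} (hθ : θ ∈ Set.Icc (3 / 4 : ℝ) 1)
    (hlam : 0 < lam) (hκ : 1 < κ) (hΔt : 0 < Δt) :
    ∀ᶠ n : ℕ in atTop, |stmAlpha θ lam κ Δt n| ≤ 1 / 2 := by
  obtain ⟨hθ0, hθ1⟩ := hθ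
  have hc : 0 < κ * lam * Δt ^ κ := by positivity
  have ht : Tendsto (fun n : ℕ => κ * lam * Δt ^ κ * ((n : ℝ) + 1) ^ (κ - 1)) atTop atTop :=
    ((tendsto_rpow_atTop (sub_pos.2 hκ)).comp
      (tendsto_atTop_add_const_right _ 1 tendsto_natCast_atTop_atTop)).const_mul_atTop hc
  filter_upwards [ht.eventually_ge_atTop 4] with n hn
  have hpow : (n : ℝ) ^ (κ - 1) ≤ ((n : ℝ) + 1) ^ (κ - 1) :=
    rpow_le_rpow (by positivity) (by linarith) (by linarith)
  have hA := mul_le_mul_of_nonneg_left hpow hc.le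
  have hA0 : 0 ≤ κ * lam * Δt ^ κ * (n : ℝ) ^ (κ - 1) := by positivity
  unfold stmAlpha
  rw [show κ * (1 - θ) * lam * (n : ℝ) ^ (κ - 1) * Δt ^ κ
      = (1 - θ) * (κ * lam * Δt ^ κ * (n : ℝ) ^ (κ - 1)) by ring,
    show κ * θ * lam * ((n : ℝ) + 1) ^ (κ - 1) * Δt ^ κ
      = θ * (κ * lam * Δt ^ κ * ((n : ℝ) + 1) ^ (κ - 1)) by ring]
  generalize κ * lam * Δt ^ κ * (n : ℝ) ^ (κ - 1) = A at *
  generalize κ * lam * Δt ^ κ * ((n : ℝ) + 1) ^ (κ - 1) = B at *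
  have hden : 0 < 1 + θ * B := by nlinarith
  rw [abs_div, abs_of_pos hden, div_le_iff₀ hden, abs_le]
  constructor <;> nlinarith

lemma abs_stmBeta_le {θ lam μ κ Δt p : ℝ} (hθ : 0 < θ) (hlam : 0 < lam) (hκ : 0 < κ)
    (hp : p ≤ κ - 1) (hΔt : 0 < Δt) (n : ℕ) :
    |stmBeta θ lam μ κ Δt n| ≤ |μ| / (κ * θ * lam * Δt ^ κ) * ((n : ℝ) + 1) ^ (-p) := by
  have hn : (1 : ℝ) ≤ (n : ℝ) + 1 := by simp
  have hpow : ((n : ℝ) + 1) ^ p ≤ ((n : ℝ) + 1) ^ (κ - 1) := rpow_le_rpow_of_exponent_le hn hp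
  have hc : 0 < κ * θ * lam * Δt ^ κ := by positivity
  have hden : κ * θ * lam * Δt ^ κ * ((n : ℝ) + 1) ^ p
      ≤ 1 + κ * θ * lam * ((n : ℝ) + 1) ^ (κ - 1) * Δt ^ κ := by
    have := mul_le_mul_of_nonneg_left hpow hc.le
    linarith
  have hpos : 0 < κ * θ * lam * Δt ^ κ * ((n : ℝ) + 1) ^ p := by positivity
  unfold stmBeta
  rw [abs_div, abs_of_pos (hpos.trans_le hden), rpow_neg (by positivity), ← div_eq_mul_inv,
    div_div]
  exact div_le_div_of_nonneg_left (abs_nonneg _) hpos hden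

lemma exists_prod_range_le_mul_pow {u : ℕ → ℝ} {q : ℝ} (hq : 0 < q) (hu : ∀ n, 0 ≤ u n)
    (h : ∀ᶠ n in atTop, u n ≤ q) :
    ∃ C, 0 ≤ C ∧ ∀ n, ∏ k ∈ Finset.range n, u k ≤ C * q ^ n := by
  obtain ⟨N, hN⟩ := eventually_atTop.1 h
  refine ⟨∏ k ∈ Finset.range N, max (u k / q) 1, by positivity, fun n => ?_⟩
  have hle : ∏ k ∈ Finset.range n, u k / q
      ≤ ∏ k ∈ Finset.range N, max (u k / q) 1 := by
    calc ∏ k ∈ Finset.range n, u k / q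
        ≤ ∏ k ∈ Finset.range n, (if k ∈ Finset.range N then max (u k / q) 1 else 1) := by
          refine Finset.prod_le_prod (fun k _ => div_nonneg (hu k) hq.le) fun k _ => ?_
          split_ifs with hk
          · exact le_max_left _ _
          · exact (div_le_one hq).2 (hN k (by simpa using hk))
      _ = ∏ k ∈ Finset.range n ∩ Finset.range N, max (u k / q) 1 := Finset.prod_ite_mem _ _ _
      _ ≤ _ := Finset.prod_mono_set_of_one_le (fun k => le_max_right _ _)
          Finset.inter_subset_right
  rwa [Finset.prod_div_distrib, Finset.prod_const, Finset.card_range,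
    div_le_iff₀ (by positivity)] at hle

/-- A linear recursion driven by fBm increments is mean square stable as soon as its deterministic
part is eventually at most `1 / 2` and its noise coefficient decays like `n ^ (-(2 * H - 1))`. -/
lemma IsfBmIncrements.tendsto_integral_sq_of_linear_recursion
    {Ω : Type*} [MeasurableSpace Ω] {P : Measure Ω} {H Δt : ℝ} (hH : H ∈ Set.Ioo (1 / 2 : ℝ) 1)
    (hΔt : 0 ≤ Δt) {V : ℕ → Ω → ℝ} (hV : IsfBmIncrements P H Δt V) {α β : ℕ → ℝ}
    (hα : ∀ᶠ n in atTop, |α n| ≤ 1 / 2) {M : ℝ}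
    (hβ : ∀ n : ℕ, |β n| ≤ M * ((n : ℝ) + 1) ^ (-(2 * H - 1)))
    {x₀ : ℝ} {X : ℕ → Ω → ℝ} (hX₀ : ∀ ω, X 0 ω = x₀)
    (hX : ∀ n ω, X (n + 1) ω = (α n + β n * V n ω) * X n ω) :
    Tendsto (fun n => ∫ ω, (X n ω) ^ 2 ∂P) atTop (nhds 0) := by
  obtain ⟨hH0, hH1⟩ := hH
  set r : ℕ → ℝ := fun n => max |α n| (1 / 2) with hr
  have hr_half : ∀ n, 1 / 2 ≤ r n := fun n => le_max_right _ _
  have hr_pos : ∀ n, 0 < r n := fun n => by linarith [hr_half n]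
  set c : ℕ → ℝ := fun n => 2 * β n / r n with hc
  obtain ⟨t, ht0, htH, ht1, ht2⟩ :
      ∃ t : ℝ, 0 ≤ t ∧ 2 * H - 1 < t ∧ t < 1 ∧ t ≤ 2 * (2 * H - 1) :=
    ⟨min (2 * (2 * H - 1)) H, le_min (by linarith) (by linarith),
      lt_min (by linarith) (by linarith), (min_le_right _ _).trans_lt hH1, min_le_left _ _⟩
  set b : ℕ → ℝ := fun n => 4 * (M * ((n : ℝ) + 1) ^ (-(2 * H - 1))) with hb
  have hcb : ∀ n, |c n| ≤ b n := by
    intro n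
    simp only [hc, hb]
    rw [abs_div, abs_mul, abs_two, abs_of_pos (hr_pos n), div_le_iff₀ (hr_pos n)]
    nlinarith [hβ n, hr_half n, abs_nonneg (β n)]
  have hsq : ∀ n ω, (X n ω) ^ 2 ≤ x₀ ^ 2 * (∏ k ∈ Finset.range n, r k ^ 2)
      * ∏ k ∈ Finset.range n, (exp (c k * V k ω) + exp (-(c k * V k ω))) := by
    intro n ω
    induction n with
    | zero => simp [hX₀]
    | succ n ih =>
      have hstep := sq_add_le_sq_mul_exp_add_exp_neg (x := β n * V n ω) (hr_pos n)
        (le_max_left |α n| (1 / 2))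
      rw [show 2 * (β n * V n ω) / r n = c n * V n ω by simp only [hc]; ring] at hstep
      rw [hX, mul_pow, Finset.prod_range_succ, Finset.prod_range_succ]
      refine (mul_le_mul hstep ih (sq_nonneg _) (by positivity)).trans_eq ?_
      ring
  obtain ⟨C, hC0, hC⟩ := exists_prod_range_le_mul_pow (u := fun n => 2 * r n ^ 2) (q := 1 / 2)
    (by norm_num) (fun n => by positivity) (by
      filter_upwards [hα] with n hn
      simp only [hr, max_eq_right hn]
      norm_num)
  set D : ℝ := 2 * H * Δt ^ (2 * H) * (16 * M ^ 2) / (1 - t) / 2 with hD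
  have hform : ∀ n : ℕ, (∑ i ∈ Finset.range n, ∑ j ∈ Finset.range n,
      b i * b j * fBmCov H Δt i j) / 2 ≤ D * (n : ℝ) ^ (2 * H - t) := by
    intro n
    rcases Nat.eq_zero_or_pos n with rfl | hn
    · simp [zero_rpow (show 2 * H - t ≠ 0 by linarith)]
    have hn' : (0 : ℝ) < n := by exact_mod_cast hn
    have hbsum : ∑ i ∈ Finset.range n, b i ^ 2
        ≤ 16 * M ^ 2 * ((n : ℝ) ^ (1 - t) / (1 - t)) := by
      refine le_trans ?_ (mul_le_mul_of_nonneg_left (sum_range_rpow_neg_le ht0 ht1 n)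
        (by positivity))
      rw [Finset.mul_sum]
      refine Finset.sum_le_sum fun i _ => ?_
      have h1 : (1 : ℝ) ≤ (i : ℝ) + 1 := by simp
      have h2 : (((i : ℝ) + 1) ^ (-(2 * H - 1))) ^ 2 ≤ ((i : ℝ) + 1) ^ (-t) := by
        rw [← rpow_mul_natCast (by positivity)]
        exact rpow_le_rpow_of_exponent_le h1 (by push_cast; linarith)
      have := mul_le_mul_of_nonneg_left h2 (show 0 ≤ 16 * M ^ 2 by positivity)
      simp only [hb]
      linarith
    have hpow : (n : ℝ) ^ (2 * H - t) = (n : ℝ) ^ (2 * H - 1) * (n : ℝ) ^ (1 - t) := by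
      rw [← rpow_add hn']; ring_nf
    have h := (sum_sum_mul_fBmCov_le hH0.le hΔt b n).trans
      (mul_le_mul_of_nonneg_left hbsum (by positivity))
    refine (div_le_div_of_nonneg_right h (by norm_num)).trans_eq ?_
    rw [hpow, hD]
    ring
  have hbound : ∀ n : ℕ, ∫ ω, (X n ω) ^ 2 ∂P
      ≤ x₀ ^ 2 * C * ((1 / 2) ^ n * exp (D * (n : ℝ) ^ (2 * H - t))) := by
    intro n
    have hint := hV.integrable_prod_exp_add_exp_neg n c
    have h1 := integral_mono_of_nonneg (μ := P) (ae_of_all _ fun ω => sq_nonneg (X n ω))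
      (hint.const_mul (x₀ ^ 2 * ∏ k ∈ Finset.range n, r k ^ 2)) (ae_of_all _ (hsq n))
    rw [integral_const_mul] at h1
    have h2 := (hV.integral_prod_exp_add_exp_neg_le hH0.le hΔt hcb n).trans
      (mul_le_mul_of_nonneg_left (exp_le_exp.2 (hform n)) (by positivity))
    have h3 := hC n
    rw [Finset.prod_mul_distrib, Finset.prod_const, Finset.card_range] at h3
    calc _ ≤ _ := h1
      _ ≤ (x₀ ^ 2 * ∏ k ∈ Finset.range n, r k ^ 2)
          * (2 ^ n * exp (D * (n : ℝ) ^ (2 * H - t))) :=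
          mul_le_mul_of_nonneg_left h2 (by positivity)
      _ = x₀ ^ 2 * (2 ^ n * ∏ k ∈ Finset.range n, r k ^ 2)
          * exp (D * (n : ℝ) ^ (2 * H - t)) := by ring
      _ ≤ x₀ ^ 2 * (C * (1 / 2) ^ n) * exp (D * (n : ℝ) ^ (2 * H - t)) := by gcongr
      _ = _ := by ring
  have hlim : Tendsto (fun n : ℕ => (1 / 2 : ℝ) ^ n * exp (D * (n : ℝ) ^ (2 * H - t)))
      atTop (nhds 0) := by
    have hneg : Tendsto (fun n : ℕ => (n : ℝ) ^ (-(t - (2 * H - 1)))) atTop (nhds 0) :=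
      (tendsto_rpow_neg_atTop (by linarith)).comp tendsto_natCast_atTop_atTop
    have hfac : Tendsto (fun n : ℕ => D * (n : ℝ) ^ (-(t - (2 * H - 1))) - log 2) atTop
        (nhds (-log 2)) := by
      simpa using (hneg.const_mul D).sub_const (log 2)
    have hexp := tendsto_exp_atBot.comp
      (tendsto_natCast_atTop_atTop.atTop_mul_neg (neg_lt_zero.2 (log_pos one_lt_two)) hfac)
    refine hexp.congr' ?_
    filter_upwards [eventually_gt_atTop 0] with n hn
    have hn' : (0 : ℝ) < n := by exact_mod_cast hn
    have hpow : (n : ℝ) ^ (2 * H - t) = n * (n : ℝ) ^ (-(t - (2 * H - 1))) := by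
      rw [← rpow_one_add' hn'.le (by linarith)]; ring_nf
    have hhalf : (1 / 2 : ℝ) ^ n = exp (-(n * log 2)) := by
      rw [exp_neg, exp_nat_mul, exp_log two_pos]; simp
    rw [hhalf, ← exp_add, hpow]
    simp only [Function.comp_apply]
    congr 1
    ring
  refine squeeze_zero (fun n => integral_nonneg fun ω => sq_nonneg _) hbound ?_
  simpa using hlim.const_mul (x₀ ^ 2 * C)

/-- Part (i) of Theorem 1.3: mean square stability of the stochastic theta method
for the fractional linear test equation when
`√(3/2)·e/(√(3/2)·e + 1) ≤ θ ≤ 1`. -/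
theorem stm_linear_fBm_meanSquareStable_largeTheta
    {Ω : Type*} [MeasurableSpace Ω] (P : Measure Ω) [IsProbabilityMeasure P]
    (H Δt κ lam μ θ : ℝ)
    (hH : H ∈ Set.Ioo (1 / 2 : ℝ) 1) (hΔt : 0 < Δt) (hκ : 2 * H ≤ κ)
    (hC : (2 * H < κ ∧ 0 < lam) ∨ (κ = 2 * H ∧ -lam + μ ^ 2 < 0))
    (hθ : θ ∈ Set.Icc (Real.sqrt (3 / 2) * Real.exp 1
        / (Real.sqrt (3 / 2) * Real.exp 1 + 1)) 1)
    (V : ℕ → Ω → ℝ) (hV : IsfBmIncrements P H Δt V)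
    (X₀ : ℝ) (hX₀ : X₀ ≠ 0) (X : ℕ → Ω → ℝ)
    (hXzero : ∀ ω, X 0 ω = X₀)
    (hXrec : ∀ n ω, X (n + 1) ω
      = (stmAlpha θ lam κ Δt n + stmBeta θ lam μ κ Δt n * V n ω) * X n ω) :
    Tendsto (fun n => ∫ ω, (X n ω) ^ 2 ∂P) atTop (nhds 0) := by
  have hlam : 0 < lam := by
    rcases hC with h | h
    · exact h.2
    · linarith [h.2, sq_nonneg μ]
  have hθ' : θ ∈ Set.Icc (3 / 4 : ℝ) 1 := ⟨three_div_four_le_of_sqrt_mul_exp_le hθ.1, hθ.2⟩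
  have hH0 := hH.1
  have hθ0 := hθ'.1
  exact hV.tendsto_integral_sq_of_linear_recursion hH hΔt.le
    (eventually_abs_stmAlpha_le hθ' hlam (by linarith) hΔt)
    (abs_stmBeta_le (by linarith) hlam (by linarith) (by linarith) hΔt) hXzero hXrec
end

section
/- Mean square stability of the stochastic theta method for the fractional linear test equation when κ > 3/2: Assume H ∈ (1/2,1), Δt > 0, κ ≥ 2H with κ > 3/2, λ, μ ∈ ℝ satisfy Condition (C), and θ ∈ (1/2, 1]. Let (V_n)_{n≥0} be a sequence of fBm increments with Hurst parameter H and step Δt, let X_0 be a nonzero real constant, and define recursively X_{n+1} = (α_n + β_n V_n)·X_n. Then lim_{n→∞} E[X_n²] = 0. -/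
open MeasureTheory ProbabilityTheory Filter Real

open Asymptotics in
/-- Partial sums of `(k + 1) ^ (-p)` with `p > 1 / 2` grow more slowly than `√n`. -/
theorem isLittleO_sum_range_rpow_neg {p : ℝ} (hp : 1 / 2 < p) :
    (fun n : ℕ => ∑ k ∈ Finset.range n, ((k : ℝ) + 1) ^ (-p))
      =o[atTop] fun n : ℕ => √(n : ℝ) := by
  have hupper (n : ℕ) : ∑ k ∈ Finset.range n, (√((k : ℝ) + 1))⁻¹ ≤ 2 * √(n : ℝ) := by
    induction n with
    | zero => simp
    | succ n ih =>
      rw [Finset.sum_range_succ]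
      have h1 : 0 < √((n : ℝ) + 1) := by positivity
      have h2 : (√((n : ℝ) + 1))⁻¹ ≤ 2 * √((n : ℝ) + 1) - 2 * √(n : ℝ) := by
        rw [inv_le_iff_one_le_mul₀ h1]
        nlinarith [Real.sq_sqrt (show (0 : ℝ) ≤ n by positivity),
          Real.sq_sqrt (show (0 : ℝ) ≤ (n : ℝ) + 1 by positivity),
          sq_nonneg (√((n : ℝ) + 1) - √(n : ℝ))]
      push_cast
      linarith
  have hlower (n : ℕ) : √(n : ℝ) ≤ ∑ k ∈ Finset.range n, (√((k : ℝ) + 1))⁻¹ := by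
    have h : ∀ k ∈ Finset.range n, (√(n : ℝ))⁻¹ ≤ (√((k : ℝ) + 1))⁻¹ := by
      intro k hk
      have : ((k : ℝ) + 1) ≤ n := by exact_mod_cast Finset.mem_range.1 hk
      gcongr
    have h2 := Finset.card_nsmul_le_sum _ _ _ h
    rw [Finset.card_range, nsmul_eq_mul, ← div_eq_mul_inv, Real.div_sqrt] at h2
    exact h2
  have hdiv : Tendsto (fun n : ℕ => ∑ k ∈ Finset.range n, (√((k : ℝ) + 1))⁻¹) atTop atTop :=
    tendsto_atTop_mono hlower (Real.tendsto_sqrt_atTop.comp tendsto_natCast_atTop_atTop)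
  have hterm : (fun k : ℕ => ((k : ℝ) + 1) ^ (-p)) =o[atTop]
      fun k : ℕ => (√((k : ℝ) + 1))⁻¹ := by
    rw [isLittleO_iff_tendsto' (Eventually.of_forall fun k h => absurd h (by positivity))]
    have ht := (tendsto_rpow_neg_atTop (sub_pos.2 hp)).comp
      (tendsto_atTop_add_const_right atTop (1 : ℝ) tendsto_natCast_atTop_atTop)
    refine ht.congr fun k => ?_
    have hk : (0 : ℝ) < (k : ℝ) + 1 := by positivity
    rw [Function.comp_apply, div_inv_eq_mul, Real.sqrt_eq_rpow, ← Real.rpow_add hk]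
    ring_nf
  refine (hterm.sum_range (fun k => by positivity) hdiv).trans_isBigO ?_
  refine IsBigO.of_bound 2 (Eventually.of_forall fun n => ?_)
  rw [Real.norm_of_nonneg (Finset.sum_nonneg fun k _ => by positivity),
    Real.norm_of_nonneg (Real.sqrt_nonneg _)]
  exact hupper n

/-- Exponential moment bound for a weighted sum of absolute values of identically distributed
centered Gaussian variables, with no assumption on their joint law. -/
theorem integral_exp_sum_abs_gaussian_le {Ω ι : Type*} [MeasurableSpace Ω] {P : Measure Ω}
    [IsProbabilityMeasure P] {V : ι → Ω → ℝ} {v : NNReal} (hm : ∀ i, Measurable (V i))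
    (hV : ∀ i, P.map (V i) = gaussianReal 0 v) (s : Finset ι) {b : ι → ℝ} (hb : ∀ i, 0 ≤ b i) :
    Integrable (fun ω => exp (∑ i ∈ s, b i * |V i ω|)) P ∧
      ∫ ω, exp (∑ i ∈ s, b i * |V i ω|) ∂P ≤ 2 * exp (v * (∑ i ∈ s, b i) ^ 2 / 2) := by
  set S := ∑ i ∈ s, b i with hS
  obtain hS0 | hSpos := (Finset.sum_nonneg fun i _ => hb i : 0 ≤ S).eq_or_lt
  · have hz := (Finset.sum_eq_zero_iff_of_nonneg fun i _ => hb i).1 hS0.symm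
    have hsum (ω : Ω) : ∑ i ∈ s, b i * |V i ω| = 0 :=
      Finset.sum_eq_zero fun i hi => by rw [hz i hi, zero_mul]
    have h1 : 1 ≤ exp (v * S ^ 2 / 2) := one_le_exp (by positivity)
    simp only [hsum, exp_zero, integrable_const, integral_const, probReal_univ, one_smul, true_and]
    linarith
  have hint (i : ι) (t : ℝ) : Integrable (fun ω => exp (t * V i ω)) P := by
    have := integrable_exp_mul_gaussianReal (μ := 0) (v := v) t
    rw [← hV i] at this
    exact this.comp_measurable (hm i)
  have hmgf (i : ι) (t : ℝ) : ∫ ω, exp (t * V i ω) ∂P = exp (v * t ^ 2 / 2) := by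
    simpa [mgf] using mgf_gaussianReal (hV i) t
  have hterm (i : ι) : Integrable
      (fun ω => b i / S * (exp (S * V i ω) + exp (-S * V i ω))) P :=
    ((hint i S).add (hint i (-S))).const_mul _
  have hpt (ω : Ω) : exp (∑ i ∈ s, b i * |V i ω|) ≤
      ∑ i ∈ s, b i / S * (exp (S * V i ω) + exp (-S * V i ω)) := by
    have hj := convexOn_exp.map_sum_le (t := s) (w := fun i => b i / S)
      (p := fun i => S * |V i ω|) (fun i _ => div_nonneg (hb i) hSpos.le)
      (by rw [← Finset.sum_div, ← hS, div_self hSpos.ne']) (fun i _ => Set.mem_univ _)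
    calc exp (∑ i ∈ s, b i * |V i ω|)
        = exp (∑ i ∈ s, (b i / S) • (S * |V i ω|)) := by
          congr 1
          refine Finset.sum_congr rfl fun i _ => ?_
          rw [smul_eq_mul, ← mul_assoc, div_mul_cancel₀ _ hSpos.ne']
      _ ≤ ∑ i ∈ s, (b i / S) • exp (S * |V i ω|) := hj
      _ ≤ _ := by
          refine Finset.sum_le_sum fun i _ => ?_
          rw [smul_eq_mul]
          refine mul_le_mul_of_nonneg_left ?_ (div_nonneg (hb i) hSpos.le)
          rcases abs_choice (V i ω) with h | h <;> rw [h]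
          · linarith [exp_pos (-S * V i ω)]
          · rw [mul_neg, ← neg_mul]
            linarith [exp_pos (S * V i ω)]
  have hdom := integrable_finsetSum s fun i _ => hterm i
  have hmeas : Measurable fun ω => exp (∑ i ∈ s, b i * |V i ω|) := by fun_prop
  have hI : Integrable (fun ω => exp (∑ i ∈ s, b i * |V i ω|)) P :=
    hdom.mono' hmeas.aestronglyMeasurable
      (Eventually.of_forall fun ω => by simpa using hpt ω)
  refine ⟨hI, (integral_mono hI hdom hpt).trans_eq ?_⟩
  rw [integral_finsetSum s fun i _ => hterm i]
  have hval (i : ι) : ∫ ω, b i / S * (exp (S * V i ω) + exp (-S * V i ω)) ∂P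
      = b i / S * (2 * exp (v * S ^ 2 / 2)) := by
    rw [integral_const_mul, integral_add (hint i S) (hint i (-S)), hmgf, hmgf, neg_sq, two_mul]
  simp_rw [hval]
  rw [← Finset.sum_mul, ← Finset.sum_div, ← hS, div_self hSpos.ne', one_mul]

theorem IsfBmIncrements.exists_map_eq_gaussianReal {Ω : Type*} [MeasurableSpace Ω] {P : Measure Ω}
    {H Δt : ℝ} {V : ℕ → Ω → ℝ} (hV : IsfBmIncrements P H Δt V) :
    ∃ v : NNReal, ∀ k, P.map (V k) = gaussianReal 0 v := by
  refine ⟨Real.toNNReal (fBmCov H Δt 0 0), fun k => ?_⟩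
  have h := hV.2 (k + 1) (fun i => if i = k then 1 else 0)
  have hcov : fBmCov H Δt k k = fBmCov H Δt 0 0 := by simp [fBmCov]
  simpa [hcov] using h

/-- For `θ > 1 / 2` the deterministic factors of the method are uniformly contracting. -/
theorem exists_abs_stmAlpha_le {θ lam κ Δt : ℝ} (hθ : θ ∈ Set.Ioc (1 / 2 : ℝ) 1)
    (hlam : 0 < lam) (hκ : 1 ≤ κ) (hΔt : 0 < Δt) :
    ∃ ρ : ℝ, 0 < ρ ∧ ρ < 1 ∧ ∀ n, |stmAlpha θ lam κ Δt n| ≤ ρ := by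
  obtain ⟨hθ0, hθ1⟩ := hθ
  have hθpos : 0 < θ := by linarith
  set c := κ * lam * Δt ^ κ with hc
  have hcpos : 0 < c := by positivity
  refine ⟨max (1 / (1 + θ * c)) ((1 - θ) / θ), lt_max_of_lt_left (by positivity), ?_, fun n => ?_⟩
  · refine max_lt ?_ ?_
    · rw [div_lt_one (by positivity)]
      nlinarith [mul_pos hθpos hcpos]
    · rw [div_lt_one hθpos]
      linarith
  set ρ := max (1 / (1 + θ * c)) ((1 - θ) / θ)
  set x := (n : ℝ) ^ (κ - 1)
  set y := ((n : ℝ) + 1) ^ (κ - 1)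
  have hx : 0 ≤ x := by positivity
  have hxy : x ≤ y := Real.rpow_le_rpow (by positivity) (by linarith) (by linarith)
  have hy : 1 ≤ y := Real.one_le_rpow (by linarith [Nat.cast_nonneg (α := ℝ) n]) (by linarith)
  have hα : stmAlpha θ lam κ Δt n = (1 - (1 - θ) * (c * x)) / (1 + θ * (c * y)) := by
    simp only [stmAlpha, hc, x, y]
    congr 1 <;> ring
  have hcx : 0 ≤ c * x := by positivity
  have hcxy : c * x ≤ c * y := by gcongr
  have hcy : c ≤ c * y := le_mul_of_one_le_right hcpos.le hy
  have hden : 0 < 1 + θ * (c * y) := by nlinarith [mul_pos hθpos (hcpos.trans_le hcy)]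
  have h1 : 1 ≤ ρ * (1 + θ * c) := (div_le_iff₀ (by positivity)).1 (le_max_left _ _)
  have h2 : 1 - θ ≤ ρ * θ := (div_le_iff₀ hθpos).1 (le_max_right _ _)
  have hρ : 0 < ρ := lt_max_of_lt_left (by positivity)
  have h3 : ρ * (1 + θ * c) ≤ ρ * (1 + θ * (c * y)) := by gcongr
  have h4 : (1 - θ) * (c * x) ≤ ρ * θ * (c * y) := by
    refine mul_le_mul h2 hcxy hcx (by positivity)
  have h5 : 0 ≤ (1 - θ) * (c * x) := mul_nonneg (by linarith) hcx
  rw [hα, abs_div, abs_of_pos hden, div_le_iff₀ hden, abs_le]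
  constructor <;> nlinarith

theorem exists_abs_stmBeta_le {θ lam κ Δt : ℝ} (μ : ℝ) (hθ : 0 < θ) (hlam : 0 < lam) (hκ : 0 < κ)
    (hΔt : 0 < Δt) :
    ∃ C : ℝ, 0 ≤ C ∧ ∀ n : ℕ, |stmBeta θ lam μ κ Δt n| ≤ C * ((n : ℝ) + 1) ^ (-(κ - 1)) := by
  refine ⟨|μ| / (κ * θ * lam * Δt ^ κ), by positivity, fun n => ?_⟩
  rw [stmBeta, abs_div, Real.rpow_neg (by positivity), ← div_eq_mul_inv, div_div,
    abs_of_pos (a := 1 + _) (by positivity)]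
  gcongr
  linarith

theorem sq_add_mul_le_exp {a b ρ B x : ℝ} (hρ : 0 < ρ) (ha : |a| ≤ ρ) (hb : |b| ≤ B) :
    (a + b * x) ^ 2 ≤ ρ ^ 2 * exp (2 / ρ * B * |x|) := by
  have h1 : |a + b * x| ≤ ρ * exp (B / ρ * |x|) :=
    calc |a + b * x| ≤ |a| + |b| * |x| := by rw [← abs_mul]; exact abs_add_le _ _
      _ ≤ ρ + B * |x| := by gcongr
      _ = ρ * (B / ρ * |x| + 1) := by field_simp; ring
      _ ≤ ρ * exp (B / ρ * |x|) := by gcongr; exact add_one_le_exp _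
  calc (a + b * x) ^ 2 = |a + b * x| ^ 2 := (sq_abs _).symm
    _ ≤ (ρ * exp (B / ρ * |x|)) ^ 2 := by gcongr
    _ = ρ ^ 2 * exp (2 / ρ * B * |x|) := by
      rw [mul_pow, ← exp_nat_mul]
      congr 2
      push_cast
      ring

/-- Part (ii) of Theorem 1.3: mean square stability of the stochastic theta method
for the fractional linear test equation when `κ > 3/2` and `1/2 < θ ≤ 1`. -/
theorem stm_linear_fBm_meanSquareStable_kappaLarge
    {Ω : Type*} [MeasurableSpace Ω] (P : Measure Ω) [IsProbabilityMeasure P]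
    (H Δt κ lam μ θ : ℝ)
    (hH : H ∈ Set.Ioo (1 / 2 : ℝ) 1) (hΔt : 0 < Δt) (hκ : 2 * H ≤ κ)
    (hκ' : 3 / 2 < κ)
    (hC : (2 * H < κ ∧ 0 < lam) ∨ (κ = 2 * H ∧ -lam + μ ^ 2 < 0))
    (hθ : θ ∈ Set.Ioc (1 / 2 : ℝ) 1)
    (V : ℕ → Ω → ℝ) (hV : IsfBmIncrements P H Δt V)
    (X₀ : ℝ) (hX₀ : X₀ ≠ 0) (X : ℕ → Ω → ℝ)
    (hXzero : ∀ ω, X 0 ω = X₀)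
    (hXrec : ∀ n ω, X (n + 1) ω
      = (stmAlpha θ lam κ Δt n + stmBeta θ lam μ κ Δt n * V n ω) * X n ω) :
    Tendsto (fun n => ∫ ω, (X n ω) ^ 2 ∂P) atTop (nhds 0) := by
  obtain ⟨hθ0, hθ1⟩ := hθ
  have hlam : 0 < lam := by
    rcases hC with h | h
    · exact h.2
    · nlinarith [h.2, sq_nonneg μ]
  obtain ⟨ρ, hρ, hρ1, hα⟩ := exists_abs_stmAlpha_le ⟨hθ0, hθ1⟩ hlam (by linarith : 1 ≤ κ) hΔt
  obtain ⟨C, hC0, hβ⟩ :=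
    exists_abs_stmBeta_le μ (by linarith : 0 < θ) hlam (by linarith : 0 < κ) hΔt
  obtain ⟨v, hv⟩ := hV.exists_map_eq_gaussianReal
  set r : ℕ → ℝ := fun k => ((k : ℝ) + 1) ^ (-(κ - 1))
  set b : ℕ → ℝ := fun k => 2 / ρ * (C * r k) with hb
  have hb0 (k : ℕ) : 0 ≤ b k := by positivity
  have hXle (n : ℕ) (ω : Ω) :
      X n ω ^ 2 ≤ X₀ ^ 2 * ρ ^ (2 * n) * exp (∑ k ∈ Finset.range n, b k * |V k ω|) := by
    induction n with
    | zero => simp [hXzero]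
    | succ n ih =>
      rw [hXrec, mul_pow, Finset.sum_range_succ, exp_add]
      calc _ ≤ (ρ ^ 2 * exp (b n * |V n ω|)) *
            (X₀ ^ 2 * ρ ^ (2 * n) * exp (∑ k ∈ Finset.range n, b k * |V k ω|)) :=
            mul_le_mul (sq_add_mul_le_exp hρ (hα n) (hβ n)) ih (sq_nonneg _) (by positivity)
        _ = _ := by ring
  have hEle (n : ℕ) : ∫ ω, X n ω ^ 2 ∂P ≤
      X₀ ^ 2 * ρ ^ (2 * n) * (2 * exp (v * (∑ k ∈ Finset.range n, b k) ^ 2 / 2)) := by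
    obtain ⟨hI, hle⟩ := integral_exp_sum_abs_gaussian_le hV.1 hv (Finset.range n) hb0
    refine (integral_mono_of_nonneg (Eventually.of_forall fun ω => sq_nonneg _)
      (hI.const_mul _) (Eventually.of_forall (hXle n))).trans ?_
    rw [integral_const_mul]
    gcongr
  have hsmall : (fun n : ℕ => (v : ℝ) / 2 * (∑ k ∈ Finset.range n, b k) ^ 2)
      =o[atTop] fun n : ℕ => √(n : ℝ) ^ 2 := by
    have h := (isLittleO_sum_range_rpow_neg (by linarith : 1 / 2 < κ - 1)).const_mul_left
      (2 / ρ * C)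
    refine ((h.pow two_pos).const_mul_left ((v : ℝ) / 2)).congr_left fun n => ?_
    simp only [hb, r, Finset.mul_sum, mul_assoc]
  have hlog : 0 < -Real.log ρ := neg_pos.2 (Real.log_neg hρ hρ1)
  have hfin : ∀ᶠ n : ℕ in atTop, ∫ ω, X n ω ^ 2 ∂P ≤ 2 * X₀ ^ 2 * ρ ^ n := by
    filter_upwards [hsmall.def hlog] with n hn
    rw [Real.norm_of_nonneg (by positivity), Real.norm_of_nonneg (by positivity),
      Real.sq_sqrt (by positivity)] at hn
    have hexp : exp (v * (∑ k ∈ Finset.range n, b k) ^ 2 / 2) ≤ (ρ ^ n)⁻¹ := by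
      rw [← Real.exp_log hρ, ← exp_nat_mul, ← exp_neg, exp_le_exp]
      linarith
    calc _ ≤ X₀ ^ 2 * ρ ^ (2 * n) * (2 * exp (v * (∑ k ∈ Finset.range n, b k) ^ 2 / 2)) := hEle n
      _ ≤ X₀ ^ 2 * ρ ^ (2 * n) * (2 * (ρ ^ n)⁻¹) := by gcongr
      _ = 2 * X₀ ^ 2 * ρ ^ n := by
        rw [two_mul n, pow_add]
        field_simp
  refine squeeze_zero' (Eventually.of_forall fun n => integral_nonneg fun ω => sq_nonneg _) hfin ?_
  simpa using (tendsto_pow_atTop_nhds_zero_of_lt_one hρ.le hρ1).const_mul (2 * X₀ ^ 2)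
end

section
/- Instability of the stochastic theta method for θ < 1/2: Assume H ∈ (1/2,1), Δt > 0, κ ≥ 2H, λ, μ ∈ ℝ with μ ≠ 0 satisfy Condition (C), and 0 < θ < 1/2. Let (V_n)_{n≥0} be a sequence of fBm increments with Hurst parameter H and step Δt, let X_0 be a nonzero real constant, and define recursively X_{n+1} = (α_n + β_n V_n)·X_n. Then (1/n)·log(X_n²) converges almost surely to the positive constant log(((1−θ)/θ)²); in particular |X_n| → ∞ almost surely and E[X_n²] → ∞, so the STM is not mean square stable. -/
open MeasureTheory ProbabilityTheory Filter Real

theorem tendsto_one_div_mul_log_sq_of_ratio_tendsto {x r : ℕ → ℝ} {a : ℝ} (hx₀ : x 0 ≠ 0)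
    (hx : ∀ n, x (n + 1) = r n * x n) (hr : ∀ n, r n ≠ 0) (ha : a ≠ 0)
    (hlim : Tendsto r atTop (nhds a)) :
    Tendsto (fun n : ℕ => (1 / (n : ℝ)) * log (x n ^ 2)) atTop (nhds (log (a ^ 2))) := by
  have hxn : ∀ n, x n ≠ 0 := fun n => by
    induction n with
    | zero => exact hx₀
    | succ n ih => rw [hx]; exact mul_ne_zero (hr n) ih
  have hlog : ∀ n, log (x n ^ 2) =
      log (x 0 ^ 2) + ∑ i ∈ Finset.range n, log (r i ^ 2) := fun n => by
    induction n with
    | zero => simp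
    | succ n ih =>
      rw [Finset.sum_range_succ, hx, mul_pow,
        log_mul (pow_ne_zero 2 (hr n)) (pow_ne_zero 2 (hxn n)), ih]
      ring
  have hces := ((hlim.pow 2).log (pow_ne_zero 2 ha)).cesaro
  have hconst := (tendsto_inv_atTop_nhds_zero_nat (𝕜 := ℝ)).mul_const (log (x 0 ^ 2))
  convert! hconst.add hces using 2 with n
  · rw [hlog]; ring
  · ring

theorem tendsto_abs_atTop_of_log_sq_rate_pos {x : ℕ → ℝ} {l : ℝ} (hl : 0 < l)
    (hlim : Tendsto (fun n : ℕ => (1 / (n : ℝ)) * log (x n ^ 2)) atTop (nhds l)) :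
    Tendsto (fun n => |x n|) atTop atTop := by
  have hlog : Tendsto (fun n => log (x n ^ 2)) atTop atTop := by
    refine (tendsto_natCast_atTop_atTop.atTop_mul_pos hl hlim).congr' ?_
    filter_upwards [eventually_gt_atTop 0] with n hn
    have : (n : ℝ) ≠ 0 := by positivity
    field_simp
  have hlog' : Tendsto (fun n => log (x n ^ 2) / 2) atTop atTop :=
    hlog.atTop_div_const two_pos
  refine (tendsto_exp_atTop.comp hlog').congr' ?_
  filter_upwards [hlog.eventually_gt_atTop 0] with n hn
  have hx : x n ≠ 0 := by
    intro h
    simp [h] at hn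
  simp only [Function.comp_apply, log_pow]
  rw [← log_abs, Nat.cast_ofNat, mul_div_cancel_left₀ _ two_ne_zero, exp_log (abs_pos.2 hx)]

theorem tendsto_integral_atTop_of_ae_tendsto_atTop {Ω : Type*} [MeasurableSpace Ω]
    {P : Measure Ω} [NeZero P] {f : ℕ → Ω → ℝ} (hint : ∀ n, Integrable (f n) P)
    (hnonneg : ∀ n, 0 ≤ᵐ[P] f n) (hf : ∀ᵐ ω ∂P, Tendsto (fun n => f n ω) atTop atTop) :
    Tendsto (fun n => ∫ ω, f n ω ∂P) atTop atTop := by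
  have htop : ∫⁻ ω, liminf (fun n => ENNReal.ofReal (f n ω)) atTop ∂P = ⊤ := by
    have hlim : (fun ω => liminf (fun n => ENNReal.ofReal (f n ω)) atTop) =ᵐ[P] fun _ => ⊤ := by
      filter_upwards [hf] with ω hω
      exact (ENNReal.tendsto_ofReal_atTop.comp hω).liminf_eq
    rw [lintegral_congr_ae hlim, lintegral_const, ENNReal.top_mul]
    exact NeZero.ne (P Set.univ)
  have hfatou := lintegral_liminf_le' (u := atTop)
    fun n => (hint n).aestronglyMeasurable.aemeasurable.ennreal_ofReal
  rw [htop, top_le_iff] at hfatou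
  rw [← ENNReal.tendsto_ofReal_nhds_top]
  refine tendsto_of_le_liminf_of_limsup_le ?_ le_top
  simp_rw [ofReal_integral_eq_lintegral_ofReal (hint _) (hnonneg _), hfatou, le_refl]

theorem ae_tendsto_mul_zero_of_map_eq {Ω : Type*} [MeasurableSpace Ω] {P : Measure Ω}
    {ν : Measure ℝ} {V : ℕ → Ω → ℝ} (hmeas : ∀ n, Measurable (V n))
    (hlaw : ∀ n, P.map (V n) = ν) {k : ℕ} (hk : k ≠ 0) (hν : MemLp id k ν)
    {b : ℕ → ℝ} (hb : Summable fun n => |b n| ^ k) :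
    ∀ᵐ ω ∂P, Tendsto (fun n => b n * V n ω) atTop (nhds 0) := by
  have hmoment : ∫⁻ x, ‖x‖ₑ ^ k ∂ν ≠ ⊤ := by
    have := (hν.integrable_norm_pow hk).hasFiniteIntegral
    rw [HasFiniteIntegral] at this
    simpa [enorm_pow] using this.ne
  have hbsum : ∑' n, ‖b n‖ₑ ^ k ≠ ⊤ := by
    have := hb.tsum_ofReal_ne_top
    convert this using 3 with n
    rw [ENNReal.ofReal_pow (abs_nonneg _), ← Real.enorm_eq_ofReal_abs]
  have hterm : ∀ n, ∫⁻ ω, ‖b n * V n ω‖ₑ ^ k ∂P = ‖b n‖ₑ ^ k * ∫⁻ x, ‖x‖ₑ ^ k ∂ν := fun n => by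
    simp_rw [enorm_mul, mul_pow]
    rw [lintegral_const_mul _ ((hmeas n).enorm.pow_const k), ← hlaw n,
      lintegral_map (by fun_prop) (hmeas n)]
  have hmeas' : ∀ n, Measurable fun ω => ‖b n * V n ω‖ₑ ^ k :=
    fun n => ((hmeas n).const_mul _).enorm.pow_const k
  have hsum : ∫⁻ ω, ∑' n, ‖b n * V n ω‖ₑ ^ k ∂P ≠ ⊤ := by
    rw [lintegral_tsum fun n => (hmeas' n).aemeasurable]
    simp_rw [hterm]
    rw [ENNReal.tsum_mul_right]
    exact ENNReal.mul_ne_top hbsum hmoment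
  filter_upwards [ae_lt_top (Measurable.tsum hmeas') hsum] with ω hω
  have hpow := ENNReal.tendsto_atTop_zero_of_tsum_ne_top hω.ne
  have hroot := hpow.ennrpow_const ((k : ℝ)⁻¹)
  rw [ENNReal.zero_rpow_of_pos (by positivity)] at hroot
  rw [tendsto_zero_iff_enorm_tendsto_zero]
  refine hroot.congr fun n => ?_
  rw [← ENNReal.rpow_natCast, ← ENNReal.rpow_mul, mul_inv_cancel₀ (by positivity),
    ENNReal.rpow_one]

theorem memLp_of_linear_recursion {Ω : Type*} [MeasurableSpace Ω] {P : Measure Ω}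
    {X R : ℕ → Ω → ℝ} (hX₀ : ∀ p : NNReal, MemLp (X 0) p P)
    (hR : ∀ n, ∀ p : NNReal, MemLp (R n) p P) (hX : ∀ n ω, X (n + 1) ω = R n ω * X n ω)
    (n : ℕ) (p : NNReal) : MemLp (X n) p P := by
  induction n generalizing p with
  | zero => exact hX₀ p
  | succ n ih =>
    have : ENNReal.HolderTriple ((2 * p : NNReal) : ENNReal) ((2 * p : NNReal) : ENNReal) p := by
      constructor
      rw [ENNReal.coe_mul, ENNReal.mul_inv (by simp) (by simp), ← add_mul, ENNReal.coe_ofNat,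
        ENNReal.inv_two_add_inv_two, one_mul]
    rw [show X (n + 1) = R n * X n from funext (hX n)]
    exact (ih (2 * p)).mul (hR n (2 * p))

theorem fBmCov_self {H : ℝ} (hH : H ≠ 0) (Δt : ℝ) (n : ℕ) : fBmCov H Δt n n = Δt ^ (2 * H) := by
  simp only [fBmCov, sub_self, zero_add, zero_sub, abs_neg, abs_one, abs_zero, one_rpow,
    zero_rpow (mul_ne_zero two_ne_zero hH)]
  ring

theorem IsfBmIncrements.map_eq {Ω : Type*} [MeasurableSpace Ω] {P : Measure Ω} {H Δt : ℝ}
    {V : ℕ → Ω → ℝ} (hV : IsfBmIncrements P H Δt V) (hH : H ≠ 0) (n : ℕ) :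
    P.map (V n) = gaussianReal 0 (Δt ^ (2 * H)).toNNReal := by
  have h := hV.2 (n + 1) (Pi.single n 1)
  simpa [Finset.sum_range_succ, Pi.single_apply, ite_and, fBmCov_self hH, eq_comm] using h

theorem tendsto_stmAlpha {θ lam κ Δt : ℝ} (hΔt : 0 < Δt) (hκ : 1 < κ) (hlam : 0 < lam)
    (hθ : 0 < θ) :
    Tendsto (stmAlpha θ lam κ Δt) atTop (nhds (-((1 - θ) / θ))) := by
  have hc : 0 < κ * lam * Δt ^ κ := by positivity
  set c := κ * lam * Δt ^ κ with hcdef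
  have hinv : Tendsto (fun n : ℕ => (((n : ℝ) + 1) ^ (κ - 1))⁻¹) atTop (nhds 0) :=
    ((tendsto_rpow_atTop (sub_pos.2 hκ)).comp
      (tendsto_natCast_atTop_atTop.atTop_add tendsto_const_nhds)).inv_tendsto_atTop
  have hratio : Tendsto (fun n : ℕ => ((n : ℝ) / (n + 1)) ^ (κ - 1)) atTop (nhds 1) := by
    simpa using (tendsto_natCast_div_add_atTop (1 : ℝ)).rpow_const
      (p := κ - 1) (Or.inl one_ne_zero)
  have hlim := (hinv.sub (hratio.const_mul ((1 - θ) * c))).div (hinv.add_const (θ * c))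
    (by positivity)
  convert! hlim using 1
  · funext n
    have hn : 0 < ((n : ℝ) + 1) ^ (κ - 1) := by positivity
    have hden : 0 < 1 + κ * θ * lam * ((n : ℝ) + 1) ^ (κ - 1) * Δt ^ κ := by positivity
    simp only [stmAlpha, Pi.div_apply]
    rw [div_rpow (by positivity) (by positivity), div_eq_div_iff hden.ne' (by positivity), hcdef]
    field_simp
  · congr 1
    field_simp
    ring

theorem exists_summable_abs_stmBeta_pow {θ lam κ Δt : ℝ} (μ : ℝ) (hΔt : 0 < Δt) (hκ : 1 < κ)
    (hlam : 0 < lam) (hθ : 0 < θ) :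
    ∃ k : ℕ, k ≠ 0 ∧ Summable fun n => |stmBeta θ lam μ κ Δt n| ^ k := by
  obtain ⟨k, hk⟩ := exists_nat_gt (1 / (κ - 1))
  have hκ' : 0 < κ - 1 := sub_pos.2 hκ
  have hexp : 1 < (κ - 1) * k := by rwa [div_lt_iff₀' hκ'] at hk
  refine ⟨k, by rintro rfl; norm_num at hexp, ?_⟩
  set c := κ * θ * lam * Δt ^ κ with hcdef
  have hc : 0 < c := by positivity
  refine Summable.of_nonneg_of_le (fun n => by positivity) (fun n => ?_)
    (((Real.summable_one_div_nat_add_rpow 1 _).2 hexp).mul_left ((|μ| / c) ^ k))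
  have hn : 0 < ((n : ℝ) + 1) ^ (κ - 1) := by positivity
  have hden : 0 < 1 + κ * θ * lam * ((n : ℝ) + 1) ^ (κ - 1) * Δt ^ κ := by positivity
  calc |stmBeta θ lam μ κ Δt n| ^ k
      ≤ (|μ| / (c * ((n : ℝ) + 1) ^ (κ - 1))) ^ k := by
        rw [stmBeta, abs_div, abs_of_pos hden]
        gcongr
        rw [hcdef]
        linarith
    _ = (|μ| / c) ^ k * (1 / |(n : ℝ) + 1| ^ ((κ - 1) * k)) := by
        rw [abs_of_pos (by positivity : (0 : ℝ) < n + 1), rpow_mul (by positivity), rpow_natCast,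
          ← div_div, div_pow _ (((n : ℝ) + 1) ^ (κ - 1))]
        ring

theorem stmBeta_ne_zero {θ lam μ κ Δt : ℝ} (hΔt : 0 < Δt) (hκ : 0 < κ) (hlam : 0 < lam)
    (hθ : 0 < θ) (hμ : μ ≠ 0) (n : ℕ) : stmBeta θ lam μ κ Δt n ≠ 0 := by
  have : 0 < 1 + κ * θ * lam * ((n : ℝ) + 1) ^ (κ - 1) * Δt ^ κ := by positivity
  exact div_ne_zero hμ this.ne'

theorem ae_add_mul_ne_zero_of_map_gaussianReal {Ω : Type*} [MeasurableSpace Ω] {P : Measure Ω}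
    {Y : Ω → ℝ} (hmeas : Measurable Y) {m : ℝ} {v : NNReal} (hv : v ≠ 0)
    (hlaw : P.map Y = gaussianReal m v) (a : ℝ) {b : ℝ} (hb : b ≠ 0) :
    ∀ᵐ ω ∂P, a + b * Y ω ≠ 0 := by
  have := nullSingletonClass_gaussianReal (μ := m) hv
  have hae : ∀ᵐ y ∂(P.map Y), y ≠ -a / b := by
    rw [hlaw]
    exact Measure.ae_ne _ _
  filter_upwards [ae_of_ae_map hmeas.aemeasurable hae] with ω hω h
  exact hω (by field_simp; linarith)

/-- Part (iii) of Theorem 1.3: instability of the stochastic theta method for the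
fractional linear test equation when `0 < θ < 1/2`: `(1/n)·log(X_n²)` converges
almost surely to the positive constant `log(((1−θ)/θ)²)`, hence `|X_n| → ∞`
almost surely and `E[X_n²] → ∞`. -/
theorem stm_linear_fBm_unstable_smallTheta
    {Ω : Type*} [MeasurableSpace Ω] (P : Measure Ω) [IsProbabilityMeasure P]
    (H Δt κ lam μ θ : ℝ)
    (hH : H ∈ Set.Ioo (1 / 2 : ℝ) 1) (hΔt : 0 < Δt) (hκ : 2 * H ≤ κ)
    (hμ : μ ≠ 0)
    (hC : (2 * H < κ ∧ 0 < lam) ∨ (κ = 2 * H ∧ -lam + μ ^ 2 < 0))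
    (hθ : θ ∈ Set.Ioo (0 : ℝ) (1 / 2))
    (V : ℕ → Ω → ℝ) (hV : IsfBmIncrements P H Δt V)
    (X₀ : ℝ) (hX₀ : X₀ ≠ 0) (X : ℕ → Ω → ℝ)
    (hXzero : ∀ ω, X 0 ω = X₀)
    (hXrec : ∀ n ω, X (n + 1) ω
      = (stmAlpha θ lam κ Δt n + stmBeta θ lam μ κ Δt n * V n ω) * X n ω) :
    (0 < Real.log (((1 - θ) / θ) ^ 2)) ∧
    (∀ᵐ ω ∂P, Tendsto (fun n : ℕ => (1 / (n : ℝ)) * Real.log ((X n ω) ^ 2))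
        atTop (nhds (Real.log (((1 - θ) / θ) ^ 2)))) ∧
    (∀ᵐ ω ∂P, Tendsto (fun n : ℕ => |X n ω|) atTop atTop) ∧
    Tendsto (fun n => ∫ ω, (X n ω) ^ 2 ∂P) atTop atTop := by
  obtain ⟨hH₁, -⟩ := hH
  obtain ⟨hθ₀, hθ₁⟩ := hθ
  have hH₀ : H ≠ 0 := by linarith
  have hκ₁ : 1 < κ := by linarith
  have hlam : 0 < lam := by
    rcases hC with h | h
    · exact h.2
    · linarith [h.2, sq_nonneg μ]
  have hv : (Δt ^ (2 * H)).toNNReal ≠ 0 := by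
    simpa using rpow_pos_of_pos hΔt (2 * H)
  have hlaw := hV.map_eq hH₀
  have hVp : ∀ n, ∀ p : NNReal, MemLp (V n) p P := fun n p =>
    (memLp_map_measure_iff aestronglyMeasurable_id (hV.1 n).aemeasurable).1
      (by rw [hlaw n]; exact memLp_id_gaussianReal p)
  have hratio : 1 < (1 - θ) / θ := (one_lt_div hθ₀).2 (by linarith)
  have hpos : 0 < Real.log (((1 - θ) / θ) ^ 2) := log_pos (one_lt_pow₀ hratio two_ne_zero)
  obtain ⟨k, hk, hsum⟩ := exists_summable_abs_stmBeta_pow μ hΔt hκ₁ hlam hθ₀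
  have hnoise := ae_tendsto_mul_zero_of_map_eq hV.1 hlaw hk
    (by exact_mod_cast memLp_id_gaussianReal (k : NNReal)) hsum
  have hne : ∀ᵐ ω ∂P, ∀ n, stmAlpha θ lam κ Δt n + stmBeta θ lam μ κ Δt n * V n ω ≠ 0 :=
    ae_all_iff.2 fun n => ae_add_mul_ne_zero_of_map_gaussianReal (hV.1 n) hv (hlaw n) _
      (stmBeta_ne_zero hΔt (by linarith) hlam hθ₀ hμ n)
  have hlog : ∀ᵐ ω ∂P, Tendsto (fun n : ℕ => (1 / (n : ℝ)) * Real.log ((X n ω) ^ 2))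
      atTop (nhds (Real.log (((1 - θ) / θ) ^ 2))) := by
    filter_upwards [hnoise, hne] with ω hω hω'
    have hlim := (tendsto_stmAlpha hΔt hκ₁ hlam hθ₀).add hω
    rw [add_zero] at hlim
    rw [← neg_sq ((1 - θ) / θ)]
    exact tendsto_one_div_mul_log_sq_of_ratio_tendsto (x := fun n => X n ω)
      (by rwa [hXzero]) (fun n => hXrec n ω) hω' (by linarith) hlim
  have habs : ∀ᵐ ω ∂P, Tendsto (fun n : ℕ => |X n ω|) atTop atTop := by
    filter_upwards [hlog] with ω hω
    exact tendsto_abs_atTop_of_log_sq_rate_pos hpos hω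
  have hXp := memLp_of_linear_recursion
    (fun p => by rw [show X 0 = fun _ => X₀ from funext hXzero]; exact memLp_const X₀)
    (fun n p => (memLp_const (stmAlpha θ lam κ Δt n)).add
      ((hVp n p).const_mul (stmBeta θ lam μ κ Δt n))) hXrec
  refine ⟨hpos, hlog, habs, tendsto_integral_atTop_of_ae_tendsto_atTop
    (fun n => (hXp n 2).integrable_sq) (fun n => ae_of_all _ fun ω => sq_nonneg _) ?_⟩
  filter_upwards [habs] with ω hω
  simpa [Function.comp_def] using (tendsto_pow_atTop two_ne_zero).comp hω
end

section
/- Mean square stability of the backward Euler method (θ = 1) for nonlinear SDEs driven by fBm: Assume H ∈ (1/2,1), Δt > 0, κ ≥ 2H, λ > 0 and μ > 0 satisfy Condition (C). Let f, g : (0,∞) × ℝ → ℝ satisfy the monotone condition x·f(t,x) ≤ −λκ t^{κ−1} x² and the uniform linear growth condition |g(t,x)| ≤ μ|x| for all t > 0 and x ∈ ℝ. Let (V_n)_{n≥0} be a sequence of fBm increments with Hurst parameter H and step Δt, set t_n = n·Δt, let X_0 be a nonzero real constant, and let (X_n)_{n≥0} be real random variables satisfying almost surely the backward Euler recursion X_{n+1}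 = X_n + f(t_{n+1}, X_{n+1})·Δt + g(t_n, X_n)·V_n for every n ≥ 0. Then lim_{n→∞} E[X_n²] = 0. -/
open MeasureTheory ProbabilityTheory Filter Real

/-- The map `x ↦ |x| ^ p` has nonnegative second differences when `1 ≤ p`. -/
lemma two_mul_abs_rpow_le {p : ℝ} (hp : 1 ≤ p) (x : ℝ) :
    2 * |x| ^ p ≤ |x + 1| ^ p + |x - 1| ^ p := by
  have h1 : |x| ≤ (1 / 2 : ℝ) * |x + 1| + (1 / 2 : ℝ) * |x - 1| := by
    have h := abs_add_le (x + 1) (x - 1)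
    rw [show x + 1 + (x - 1) = 2 * x by ring, abs_mul, abs_two] at h
    linarith
  have h2 := (convexOn_rpow hp).2 (Set.mem_Ici.2 (abs_nonneg (x + 1)))
    (Set.mem_Ici.2 (abs_nonneg (x - 1))) (by norm_num : (0 : ℝ) ≤ 1 / 2)
    (by norm_num : (0 : ℝ) ≤ 1 / 2) (by norm_num)
  simp only [smul_eq_mul] at h2
  have h3 := rpow_le_rpow (abs_nonneg x) h1 (by linarith : 0 ≤ p)
  linarith

/-- The total covariance of the first `n` increments is the variance `(n Δt) ^ (2 H)` of the
fractional Brownian motion at time `n Δt`. -/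
lemma sum_fBmCov {H Δt : ℝ} (hH : 0 < H) (n : ℕ) :
    ∑ i ∈ Finset.range n, ∑ j ∈ Finset.range n, fBmCov H Δt i j
      = Δt ^ (2 * H) * (n : ℝ) ^ (2 * H) := by
  have h0 : (0 : ℝ) ^ (2 * H) = 0 := zero_rpow (by positivity)
  induction n with
  | zero => simp [h0]
  | succ n ih =>
    have hrow : ∑ i ∈ Finset.range n, fBmCov H Δt i n
        = Δt ^ (2 * H) / 2 * (((n : ℝ) + 1) ^ (2 * H) - (n : ℝ) ^ (2 * H) - 1) := by
      have h := Finset.sum_range_sub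
        (fun i : ℕ => |(i : ℝ) - n| ^ (2 * H) - |(i : ℝ) - n - 1| ^ (2 * H)) n
      have hl : |(-(n : ℝ)) - 1| = n + 1 := by
        rw [show -(n : ℝ) - 1 = -(n + 1) by ring, abs_neg, abs_of_nonneg (by positivity)]
      simp only [sub_self, abs_zero, h0, zero_sub, abs_neg, abs_one, one_rpow, Nat.cast_zero,
        Nat.abs_cast, hl] at h
      rw [show ((n : ℝ) + 1) ^ (2 * H) - (n : ℝ) ^ (2 * H) - 1
        = -1 - ((n : ℝ) ^ (2 * H) - ((n : ℝ) + 1) ^ (2 * H)) by ring, ← h, Finset.mul_sum]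
      refine Finset.sum_congr rfl fun i _ => ?_
      unfold fBmCov
      push_cast
      rw [show (i : ℝ) + 1 - n = i - n + 1 by ring, show (i : ℝ) - n + 1 - 1 = i - n by ring]
      ring
    have hdiag : fBmCov H Δt n n = Δt ^ (2 * H) := by simp [fBmCov, h0]; ring
    rw [Finset.sum_range_succ]
    simp_rw [Finset.sum_range_succ _ n]
    rw [Finset.sum_add_distrib, ih, hdiag]
    simp_rw [fBmCov_comm H Δt n]
    rw [hrow]
    push_cast
    ring

section ExponentialMoments

variable {Ω : Type*} [MeasurableSpace Ω] {P : Measure Ω} {H Δt : ℝ} {V : ℕ → Ω → ℝ}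

/-- Exponential moments of linear combinations of fBm increments with coefficients of
modulus at most `s`. -/
lemma IsfBmIncrements.integrable_exp_and_integral_le (hV : IsfBmIncrements P H Δt V)
    (hH : 1 / 2 ≤ H) (hΔt : 0 ≤ Δt) {s : ℝ} (n : ℕ) (c : ℕ → ℝ) (hc : ∀ i, |c i| ≤ s) :
    Integrable (fun ω => exp (∑ i ∈ Finset.range n, c i * V i ω)) P ∧
      ∫ ω, exp (∑ i ∈ Finset.range n, c i * V i ω) ∂P
        ≤ exp (s ^ 2 * (Δt ^ (2 * H) * (n : ℝ) ^ (2 * H)) / 2) := by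
  have hs : 0 ≤ s := (abs_nonneg _).trans (hc 0)
  have hm : Measurable fun ω => ∑ i ∈ Finset.range n, c i * V i ω :=
    Finset.measurable_sum _ fun i _ => (hV.1 i).const_mul _
  constructor
  · have h := integrable_exp_mul_gaussianReal (μ := 0)
      (v := Real.toNNReal (∑ i ∈ Finset.range n, ∑ j ∈ Finset.range n,
              c i * c j * fBmCov H Δt i j)) 1
    rw [← hV.2 n c, integrable_map_measure (by fun_prop) hm.aemeasurable] at h
    simpa [Function.comp_def] using h
  · have h := mgf_gaussianReal (hV.2 n c) 1
    simp only [mgf, one_mul, one_pow, mul_one, zero_add] at h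
    rw [h, exp_le_exp, coe_toNNReal']
    have hvar : ∑ i ∈ Finset.range n, ∑ j ∈ Finset.range n, c i * c j * fBmCov H Δt i j
        ≤ s ^ 2 * (Δt ^ (2 * H) * (n : ℝ) ^ (2 * H)) := by
      rw [← sum_fBmCov (by linarith), Finset.mul_sum]
      refine Finset.sum_le_sum fun i _ => ?_
      rw [Finset.mul_sum]
      refine Finset.sum_le_sum fun j _ => ?_
      refine mul_le_mul_of_nonneg_right ?_ (fBmCov_nonneg hH hΔt i j)
      calc c i * c j ≤ |c i| * |c j| := by rw [← abs_mul]; exact le_abs_self _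
        _ ≤ s * s := mul_le_mul (hc i) (hc j) (abs_nonneg _) hs
        _ = s ^ 2 := by ring
    gcongr
    exact max_le hvar (by positivity)

/-- Exponential moments of the sum of the absolute values of fBm increments. -/
lemma IsfBmIncrements.integrable_exp_abs_and_integral_le (hV : IsfBmIncrements P H Δt V)
    (hH : 1 / 2 ≤ H) (hΔt : 0 ≤ Δt) {s : ℝ} (hs : 0 ≤ s) (n : ℕ) :
    Integrable (fun ω => exp (s * ∑ i ∈ Finset.range n, |V i ω|)) P ∧
      ∫ ω, exp (s * ∑ i ∈ Finset.range n, |V i ω|) ∂P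
        ≤ 2 ^ n * exp (s ^ 2 * (Δt ^ (2 * H) * (n : ℝ) ^ (2 * H)) / 2) := by
  classical
  let c : Finset ℕ → ℕ → ℝ := fun T i => if i ∈ T then s else -s
  have hc : ∀ T i, |c T i| ≤ s := by
    intro T i
    by_cases h : i ∈ T <;> simp [c, h, abs_of_nonneg hs]
  have key := fun T => hV.integrable_exp_and_integral_le hH hΔt n (c T) (hc T)
  have hle : ∀ ω, exp (s * ∑ i ∈ Finset.range n, |V i ω|)
      ≤ ∑ T ∈ (Finset.range n).powerset, exp (∑ i ∈ Finset.range n, c T i * V i ω) := by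
    intro ω
    calc exp (s * ∑ i ∈ Finset.range n, |V i ω|)
        = ∏ i ∈ Finset.range n, exp (s * |V i ω|) := by rw [Finset.mul_sum, exp_sum]
      _ ≤ ∏ i ∈ Finset.range n, (exp (s * V i ω) + exp (-s * V i ω)) := by
        refine Finset.prod_le_prod (fun i _ => (exp_pos _).le) fun i _ => ?_
        rcases abs_choice (V i ω) with h | h <;> rw [h]
        · exact le_add_of_nonneg_right (exp_pos _).le
        · rw [mul_neg, ← neg_mul]
          exact le_add_of_nonneg_left (exp_pos _).le
      _ = _ := by
        rw [Finset.prod_add]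
        refine Finset.sum_congr rfl fun T hT => ?_
        rw [exp_sum, ← Finset.inter_eq_right.2 (Finset.mem_powerset.1 hT),
          Finset.sdiff_inter_self_left, ← Finset.prod_piecewise,
          Finset.inter_eq_right.2 (Finset.mem_powerset.1 hT)]
        refine Finset.prod_congr rfl fun i _ => ?_
        by_cases h : i ∈ T <;> simp [c, h]
  have h_int_sum : Integrable (fun ω => ∑ T ∈ (Finset.range n).powerset,
      exp (∑ i ∈ Finset.range n, c T i * V i ω)) P :=
    integrable_finsetSum _ fun T _ => (key T).1
  have hm : Measurable fun ω => exp (s * ∑ i ∈ Finset.range n, |V i ω|) :=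
    ((Finset.measurable_sum _ fun i _ => (hV.1 i).norm).const_mul s).exp
  have h_int_abs : Integrable (fun ω => exp (s * ∑ i ∈ Finset.range n, |V i ω|)) P := by
    refine h_int_sum.mono' hm.aestronglyMeasurable (ae_of_all _ fun ω => ?_)
    rw [norm_of_nonneg (exp_pos _).le]
    exact hle ω
  refine ⟨h_int_abs, (integral_mono h_int_abs h_int_sum hle).trans ?_⟩
  rw [integral_finsetSum _ fun T _ => (key T).1]
  refine (Finset.sum_le_card_nsmul _ _ _ fun T _ => (key T).2).trans_eq ?_
  simp

end ExponentialMoments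

/-- A step of an implicit scheme with monotone drift is a contraction. -/
lemma abs_mul_one_add_le_of_implicit_step {x y F r Δt : ℝ} (hΔt : 0 ≤ Δt)
    (h : x = y + F * Δt) (hF : x * F ≤ -r * x ^ 2) : |x| * (1 + r * Δt) ≤ |y| := by
  rcases eq_or_ne x 0 with rfl | hx
  · simp
  have h1 : x * F * Δt ≤ -r * x ^ 2 * Δt := mul_le_mul_of_nonneg_right hF hΔt
  have h2 : x * y ≤ |x| * |y| := by rw [← abs_mul]; exact le_abs_self _
  have h3 : x ^ 2 = x * y + x * F * Δt := by
    conv_lhs => rw [sq]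
    nth_rewrite 2 [h]
    ring
  refine le_of_mul_le_mul_left ?_ (abs_pos.2 hx)
  have h4 : |x| * (|x| * (1 + r * Δt)) = x ^ 2 + r * x ^ 2 * Δt := by
    rw [← sq_abs x]
    ring
  linarith

/-- Product bound for a path of the backward Euler recursion. -/
lemma abs_mul_prod_le_of_backwardEuler {κ lam μ Δt : ℝ} (hΔt : 0 < Δt) (hκ : 0 ≤ κ)
    (hlam : 0 ≤ lam) (hμ : 0 < μ) {f g : ℝ → ℝ → ℝ}
    (hmono : ∀ t > (0 : ℝ), ∀ x : ℝ, x * f t x ≤ -lam * κ * t ^ (κ - 1) * x ^ 2)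
    (hg : ∀ t > (0 : ℝ), ∀ x : ℝ, |g t x| ≤ μ * |x|) {x v : ℕ → ℝ}
    (hrec : ∀ n : ℕ, x (n + 1) = x n + f ((n + 1 : ℕ) * Δt) (x (n + 1)) * Δt
        + g ((n : ℕ) * Δt) (x n) * v n) (n : ℕ) :
    |x n| * ∏ i ∈ Finset.range n, (1 + lam * κ * ((i + 1 : ℕ) * Δt) ^ (κ - 1) * Δt)
      ≤ (|x 0| + |g 0 (x 0)| / μ) * ∏ i ∈ Finset.range n, (1 + μ * |v i|) := by
  have hstep : ∀ n : ℕ, |x (n + 1)| * (1 + lam * κ * ((n + 1 : ℕ) * Δt) ^ (κ - 1) * Δt)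
      ≤ |x n| + |g ((n : ℕ) * Δt) (x n)| * |v n| := by
    intro n
    have ht : 0 < ((n + 1 : ℕ) : ℝ) * Δt := by positivity
    refine (abs_mul_one_add_le_of_implicit_step (y := x n + g ((n : ℕ) * Δt) (x n) * v n)
      (F := f ((n + 1 : ℕ) * Δt) (x (n + 1))) hΔt.le (by linarith [hrec n]) ?_).trans ?_
    · linarith [hmono _ ht (x (n + 1))]
    · rw [← abs_mul]
      exact abs_add_le _ _
  induction n with
  | zero => simpa using div_nonneg (abs_nonneg (g 0 (x 0))) hμ.le
  | succ n ih =>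
    rw [Finset.prod_range_succ, Finset.prod_range_succ]
    rcases Nat.eq_zero_or_pos n with rfl | hn
    · have h := hstep 0
      simp only [Nat.cast_zero, zero_mul] at h
      simp only [Finset.range_zero, Finset.prod_empty, one_mul]
      refine h.trans ?_
      have h1 : (|x 0| + |g 0 (x 0)| / μ) * (1 + μ * |v 0|)
          = |x 0| + |g 0 (x 0)| * |v 0| + (|x 0| * (μ * |v 0|) + |g 0 (x 0)| / μ) := by
        field_simp
        ring
      rw [h1]
      exact le_add_of_nonneg_right (by positivity)
    · have ht : 0 < (n : ℝ) * Δt := by positivity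
      have h1 : |x (n + 1)| * (1 + lam * κ * ((n + 1 : ℕ) * Δt) ^ (κ - 1) * Δt)
          ≤ |x n| * (1 + μ * |v n|) := by
        refine (hstep n).trans ?_
        have := mul_le_mul_of_nonneg_right (hg _ ht (x n)) (abs_nonneg (v n))
        linarith
      have hpos : 0 ≤ ∏ i ∈ Finset.range n, (1 + lam * κ * ((i + 1 : ℕ) * Δt) ^ (κ - 1) * Δt) :=
        Finset.prod_nonneg fun i _ => by positivity
      have hv : 0 ≤ 1 + μ * |v n| := by positivity
      have h2 := mul_le_mul_of_nonneg_right h1 hpos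
      have h3 := mul_le_mul_of_nonneg_right ih hv
      linarith

/-- The drift damping factors grow at least like a power of the factorial. -/
lemma pow_le_prod_one_add_rpow {κ lam Δt q : ℝ} (hΔt : 0 < Δt) (hκ : 0 ≤ κ) (hlam : 0 ≤ lam)
    (hq : 0 ≤ q) (hqκ : q ≤ κ - 1) (n : ℕ) :
    (lam * κ * Δt ^ κ * (n : ℝ) ^ q * exp (-q)) ^ n
      ≤ ∏ i ∈ Finset.range n, (1 + lam * κ * ((i + 1 : ℕ) * Δt) ^ (κ - 1) * Δt) := by
  have hfac : ((n : ℝ) ^ q * exp (-q)) ^ n ≤ (n.factorial : ℝ) ^ q := by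
    have h := pow_div_factorial_le_exp (n : ℝ) (Nat.cast_nonneg n) n
    rw [div_le_iff₀ (by positivity)] at h
    have h1 : (n : ℝ) ^ n * exp (-n) ≤ n.factorial := by
      rw [exp_neg, ← div_eq_mul_inv, div_le_iff₀ (exp_pos _)]
      linarith
    have h2 := rpow_le_rpow (by positivity) h1 hq
    rw [mul_rpow (by positivity) (by positivity), ← exp_mul] at h2
    rw [mul_pow, ← exp_nat_mul]
    convert h2 using 2
    · rw [← rpow_natCast, ← rpow_mul (by positivity), ← rpow_natCast, ← rpow_mul (by positivity),
        mul_comm]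
    · ring_nf
  calc (lam * κ * Δt ^ κ * (n : ℝ) ^ q * exp (-q)) ^ n
      = (lam * κ * Δt ^ κ) ^ n * ((n : ℝ) ^ q * exp (-q)) ^ n := by rw [← mul_pow]; ring
    _ ≤ (lam * κ * Δt ^ κ) ^ n * (n.factorial : ℝ) ^ q := by gcongr
    _ = ∏ i ∈ Finset.range n, (lam * κ * Δt ^ κ * ((i + 1 : ℕ) : ℝ) ^ q) := by
      rw [Finset.prod_mul_distrib, Finset.prod_const, Finset.card_range,
        finsetProd_rpow _ _ fun i _ => Nat.cast_nonneg _, ← Nat.cast_prod,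
        Finset.prod_range_add_one_eq_factorial]
    _ ≤ _ := by
      refine Finset.prod_le_prod (fun i _ => by positivity) fun i _ => ?_
      have h1 : ((i + 1 : ℕ) : ℝ) ^ q ≤ ((i + 1 : ℕ) : ℝ) ^ (κ - 1) :=
        rpow_le_rpow_of_exponent_le (by simp) hqκ
      have h2 : Δt ^ κ = Δt ^ (κ - 1) * Δt := by
        rw [← rpow_add_one hΔt.ne', sub_add_cancel]
      rw [mul_rpow (by positivity) hΔt.le, h2]
      have h3 : lam * κ * (Δt ^ (κ - 1) * Δt) * ((i + 1 : ℕ) : ℝ) ^ q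
          ≤ lam * κ * (Δt ^ (κ - 1) * Δt) * ((i + 1 : ℕ) : ℝ) ^ (κ - 1) := by gcongr
      linarith

/-- A product of affine functions is bounded by an exponential, with a free parameter `A`. -/
lemma pow_mul_prod_one_add_le_exp {μ A : ℝ} (hμ : 0 ≤ μ) (hA : 0 ≤ A) (hA1 : A ≤ 1)
    (v : ℕ → ℝ) (n : ℕ) :
    A ^ n * ∏ i ∈ Finset.range n, (1 + μ * |v i|)
      ≤ exp 1 ^ n * exp (A * μ * ∑ i ∈ Finset.range n, |v i|) := by
  have hconst : ∀ r : ℝ, r ^ n = ∏ _i ∈ Finset.range n, r := fun r => by simp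
  rw [hconst, hconst, Finset.mul_sum, exp_sum, ← Finset.prod_mul_distrib,
    ← Finset.prod_mul_distrib]
  refine Finset.prod_le_prod (fun i _ => by positivity) fun i _ => ?_
  rw [← exp_add]
  have h := add_one_le_exp (A * (1 + μ * |v i|))
  refine (by linarith : A * (1 + μ * |v i|) ≤ exp (A * (1 + μ * |v i|))).trans ?_
  rw [exp_le_exp]
  linarith

/-- A power whose base decays like a negative power of the exponent tends to zero. -/
lemma tendsto_mul_rpow_neg_pow_atTop_nhds_zero {C q : ℝ} (hC : 0 ≤ C) (hq : 0 < q) :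
    Tendsto (fun n : ℕ => (C * (n : ℝ) ^ (-q)) ^ n) atTop (nhds 0) := by
  have h : Tendsto (fun n : ℕ => C * (n : ℝ) ^ (-q)) atTop (nhds 0) := by
    simpa using ((tendsto_rpow_neg_atTop hq).comp tendsto_natCast_atTop_atTop).const_mul C
  refine tendsto_of_tendsto_of_tendsto_of_le_of_le' tendsto_const_nhds
    (tendsto_pow_atTop_nhds_zero_of_lt_one (r := (1 / 2 : ℝ)) (by norm_num) (by norm_num))
    (Eventually.of_forall fun n => by positivity) ?_
  filter_upwards [h.eventually_le_const (by norm_num : (0 : ℝ) < 1 / 2)] with n hn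
  exact pow_le_pow_left₀ (by positivity) hn n

/-- Part (i) of Theorem 1.5: mean square stability of the backward Euler method
(`θ = 1`) for nonlinear SDEs driven by fBm, under the monotone condition on the
drift and the uniform linear growth condition on the diffusion. -/
theorem backwardEuler_fBm_nonlinear_meanSquareStable
    {Ω : Type*} [MeasurableSpace Ω] (P : Measure Ω) [IsProbabilityMeasure P]
    (H Δt κ lam μ : ℝ)
    (hH : H ∈ Set.Ioo (1 / 2 : ℝ) 1) (hΔt : 0 < Δt) (hκ : 2 * H ≤ κ)
    (hlam : 0 < lam) (hμ : 0 < μ)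
    (hC : (2 * H < κ ∧ 0 < lam) ∨ (κ = 2 * H ∧ -lam + μ ^ 2 < 0))
    (f g : ℝ → ℝ → ℝ)
    (hmono : ∀ t > (0 : ℝ), ∀ x : ℝ, x * f t x ≤ -lam * κ * t ^ (κ - 1) * x ^ 2)
    (hg : ∀ t > (0 : ℝ), ∀ x : ℝ, |g t x| ≤ μ * |x|)
    (V : ℕ → Ω → ℝ) (hV : IsfBmIncrements P H Δt V)
    (X₀ : ℝ) (hX₀ : X₀ ≠ 0) (X : ℕ → Ω → ℝ)
    (hXmeas : ∀ n, Measurable (X n))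
    (hXzero : ∀ ω, X 0 ω = X₀)
    (hXrec : ∀ᵐ ω ∂P, ∀ n : ℕ, X (n + 1) ω
      = X n ω + f ((n + 1 : ℕ) * Δt) (X (n + 1) ω) * Δt
        + g ((n : ℕ) * Δt) (X n ω) * V n ω) :
    Tendsto (fun n => ∫ ω, (X n ω) ^ 2 ∂P) atTop (nhds 0) := by
  obtain ⟨hH1, hH2⟩ := hH
  have hκ0 : 0 < κ := by linarith
  set q : ℝ := 2 * H - 1 with hq
  have hq0 : 0 < q := by linarith
  set K : ℝ := |X₀| + |g 0 X₀| / μ with hK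
  set b : ℝ := lam * κ * Δt ^ κ * exp (-q) with hb
  have hb0 : 0 < b := by positivity
  set D : ℝ := exp (2 * μ ^ 2 * Δt ^ (2 * H)) with hD
  have hbound : ∀ n : ℕ, 0 < n → ∫ ω, (X n ω) ^ 2 ∂P
      ≤ K ^ 2 * (exp 1 ^ 2 * 2 * D / b ^ 2 * (n : ℝ) ^ (-q)) ^ n := by
    intro n hn
    have hn0 : (0 : ℝ) < n := by exact_mod_cast hn
    set A : ℝ := (n : ℝ) ^ (-(q / 2)) with hA
    have hA0 : 0 < A := by positivity
    have hA1 : A ≤ 1 := rpow_le_one_of_one_le_of_nonpos (by exact_mod_cast hn) (by linarith)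
    have hA2 : A ^ 2 = (n : ℝ) ^ (-q) := by
      rw [hA, ← rpow_natCast, ← rpow_mul hn0.le]
      congr 1
      push_cast
      ring
    have hAn : A ^ 2 * (n : ℝ) ^ (2 * H) = n := by
      rw [hA2, ← rpow_add hn0, hq, show -(2 * H - 1) + 2 * H = 1 by ring, rpow_one]
    have hAq : A ^ 2 * (n : ℝ) ^ q = 1 := by
      rw [hA2, ← rpow_add hn0, neg_add_cancel, rpow_zero]
    have hexp := hV.integrable_exp_abs_and_integral_le hH1.le hΔt.le
      (s := 2 * (A * μ)) (by positivity) n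
    have hB : 0 < b * (n : ℝ) ^ q * A := by positivity
    have hpt : ∀ᵐ ω ∂P, (X n ω) ^ 2 ≤ (K * (exp 1 / (b * (n : ℝ) ^ q * A)) ^ n) ^ 2
        * exp (2 * (A * μ) * ∑ i ∈ Finset.range n, |V i ω|) := by
      filter_upwards [hXrec] with ω hω
      have h1 := abs_mul_prod_le_of_backwardEuler hΔt hκ0.le hlam.le hμ hmono hg
        (x := fun n => X n ω) (v := fun n => V n ω) hω n
      simp only [hXzero] at h1
      have h2 := pow_le_prod_one_add_rpow hΔt hκ0.le hlam.le hq0.le (by linarith : q ≤ κ - 1) n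
      have h3 := pow_mul_prod_one_add_le_exp hμ.le hA0.le hA1 (fun n => V n ω) n
      rw [show lam * κ * Δt ^ κ * (n : ℝ) ^ q * exp (-q) = b * (n : ℝ) ^ q by rw [hb]; ring] at h2
      have h4 : |X n ω| ≤ K * (exp 1 / (b * (n : ℝ) ^ q * A)) ^ n
          * exp (A * μ * ∑ i ∈ Finset.range n, |V i ω|) := by
        rw [div_pow, ← mul_div_assoc, div_mul_eq_mul_div, le_div_iff₀ (by positivity), mul_pow]
        calc |X n ω| * ((b * (n : ℝ) ^ q) ^ n * A ^ n)
            ≤ (K * ∏ i ∈ Finset.range n, (1 + μ * |V i ω|)) * A ^ n := by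
              rw [← mul_assoc]
              exact mul_le_mul_of_nonneg_right
                ((mul_le_mul_of_nonneg_left h2 (abs_nonneg _)).trans h1) (by positivity)
          _ = K * (A ^ n * ∏ i ∈ Finset.range n, (1 + μ * |V i ω|)) := by ring
          _ ≤ K * (exp 1 ^ n * exp (A * μ * ∑ i ∈ Finset.range n, |V i ω|)) :=
              mul_le_mul_of_nonneg_left h3 (by positivity)
          _ = _ := by ring
      rw [← sq_abs]
      refine (pow_le_pow_left₀ (abs_nonneg _) h4 2).trans_eq ?_
      rw [mul_pow, ← exp_nat_mul]
      push_cast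
      ring_nf
    calc ∫ ω, (X n ω) ^ 2 ∂P
        ≤ ∫ ω, (K * (exp 1 / (b * (n : ℝ) ^ q * A)) ^ n) ^ 2
            * exp (2 * (A * μ) * ∑ i ∈ Finset.range n, |V i ω|) ∂P :=
          integral_mono_of_nonneg (ae_of_all _ fun ω => sq_nonneg _) (hexp.1.const_mul _) hpt
      _ ≤ (K * (exp 1 / (b * (n : ℝ) ^ q * A)) ^ n) ^ 2 * (2 ^ n
            * exp ((2 * (A * μ)) ^ 2 * (Δt ^ (2 * H) * (n : ℝ) ^ (2 * H)) / 2)) := by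
          rw [integral_const_mul]
          exact mul_le_mul_of_nonneg_left hexp.2 (sq_nonneg _)
      _ = (K * (exp 1 / (b * (n : ℝ) ^ q * A)) ^ n) ^ 2 * (2 ^ n * D ^ n) := by
          rw [hD, ← exp_nat_mul]
          congr 3
          linear_combination 2 * μ ^ 2 * Δt ^ (2 * H) * hAn
      _ = K ^ 2 * ((exp 1 / (b * (n : ℝ) ^ q * A)) ^ 2 * 2 * D) ^ n := by
          rw [mul_pow K, mul_pow, mul_pow, pow_right_comm]
          ring
      _ = _ := by
          congr 2
          rw [← hA2]
          have hnq : (n : ℝ) ^ q = (A ^ 2)⁻¹ := eq_inv_of_mul_eq_one_right hAq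
          rw [hnq]
          field_simp
  have hlim : Tendsto (fun n : ℕ => K ^ 2 * (exp 1 ^ 2 * 2 * D / b ^ 2 * (n : ℝ) ^ (-q)) ^ n)
      atTop (nhds 0) := by
    simpa using (tendsto_mul_rpow_neg_pow_atTop_nhds_zero (by positivity) hq0).const_mul (K ^ 2)
  refine tendsto_of_tendsto_of_tendsto_of_le_of_le' tendsto_const_nhds hlim
    (Eventually.of_forall fun n => integral_nonneg fun ω => sq_nonneg _) ?_
  filter_upwards [eventually_gt_atTop 0] with n hn using hbound n hn
end

section
/- Generalized polarization identity: Let x_1, …, x_n be real numbers, let s_1, …, s_n be nonnegative integers and set s = s_1 + ⋯ + s_n. Then x_1^{s_1}·x_2^{s_2}⋯x_n^{s_n} = (1/s!)·Σ_{v_1=0}^{s_1}⋯Σ_{v_n=0}^{s_n} (−1)^{v_1+⋯+v_n}·C(s_1,v_1)⋯C(s_n,v_n)·( Σ_{i=1}^n (s_i/2 − v_i)·x_i )^{s}, where C(s_i,v_i) denotes the binomial coefficient and the coefficients h_i = s_i/2 − v_i are rational numbers. -/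
open Finset in
theorem sum_neg_one_pow_mul_choose_mul_half_sub_pow (m k : ℕ) :
    ∑ v ∈ range (m + 1), (-1 : ℝ) ^ v * (m.choose v : ℝ) * ((m : ℝ) / 2 - v) ^ k =
      (fwdDiff 1)^[m] (fun r : ℝ ↦ r ^ k) (-(m : ℝ) / 2) := by
  rw [fwdDiff_iter_eq_sum_shift, ← sum_range_reflect]
  refine sum_congr rfl fun v hv ↦ ?_
  have hv : v ≤ m := by simpa [Nat.lt_succ_iff] using hv
  rw [Nat.add_sub_cancel, Nat.choose_symm hv, Nat.cast_sub hv]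
  simp only [zsmul_eq_mul, nsmul_eq_mul, mul_one]
  push_cast
  congr 2
  ring

open Finset in
/-- The coefficient of `∏ i, x i ^ k i` (up to a multinomial factor) in the polarization sum. -/
theorem prod_sum_neg_one_pow_mul_choose_mul_half_sub_pow {ι : Type*} [Fintype ι] [DecidableEq ι]
    (s k : ι → ℕ) (h : ∑ i, k i = ∑ i, s i) :
    ∏ i, ∑ v ∈ range (s i + 1),
        (-1 : ℝ) ^ v * ((s i).choose v : ℝ) * ((s i : ℝ) / 2 - v) ^ k i =
      if k = s then ∏ i, ((s i).factorial : ℝ) else 0 := by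
  simp only [sum_neg_one_pow_mul_choose_mul_half_sub_pow]
  split_ifs with hks
  · subst hks
    simp [fwdDiff_iter_eq_factorial]
  · obtain ⟨i, hi⟩ : ∃ i, k i < s i := by
      by_contra! hle
      have := (sum_eq_sum_iff_of_le fun i _ ↦ hle i).mp h.symm
      exact hks (funext fun i ↦ (this i (mem_univ i)).symm)
    exact prod_eq_zero (mem_univ i) (by rw [fwdDiff_iter_pow_eq_zero_of_lt hi]; rfl)

/-- Generalized polarization identity (Lemma 2.1): a monomial
`x₁^{s₁} ⋯ x_n^{s_n}` equals a signed combination of `s`-th powers of linear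
forms, where `s = s₁ + ⋯ + s_n` and `h_i = s_i/2 − v_i`. -/
theorem generalized_polarization (n : ℕ) (x : Fin n → ℝ) (s : Fin n → ℕ) :
    (∏ i, x i ^ s i) =
      (1 / (Nat.factorial (∑ i, s i) : ℝ)) *
        ∑ v ∈ Fintype.piFinset (fun i => Finset.range (s i + 1)),
          (-1 : ℝ) ^ (∑ i, v i) *
            (∏ i, ((s i).choose (v i) : ℝ)) *
            (∑ i, ((s i : ℝ) / 2 - (v i : ℝ)) * x i) ^ (∑ i, s i) := by
  have key : ∀ k ∈ Finset.univ.piAntidiag (∑ i, s i),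
      ∑ v ∈ Fintype.piFinset (fun i => Finset.range (s i + 1)),
        (-1 : ℝ) ^ (∑ i, v i) * (∏ i, ((s i).choose (v i) : ℝ)) *
          ((Nat.multinomial Finset.univ k : ℝ) *
            ∏ i, (((s i : ℝ) / 2 - (v i : ℝ)) * x i) ^ k i) =
      if k = s then (Nat.factorial (∑ i, s i) : ℝ) * ∏ i, x i ^ s i else 0 := by
    intro k hk
    have hsum : ∑ i, k i = ∑ i, s i := (Finset.mem_piAntidiag.mp hk).1
    calc
      _ = (Nat.multinomial Finset.univ k : ℝ) * (∏ i, x i ^ k i) *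
          ∏ i, ∑ v ∈ Finset.range (s i + 1),
            (-1 : ℝ) ^ v * ((s i).choose v : ℝ) * ((s i : ℝ) / 2 - v) ^ k i := by
        rw [Finset.prod_univ_sum, Finset.mul_sum]
        refine Finset.sum_congr rfl fun v _ ↦ ?_
        simp only [mul_pow, Finset.prod_mul_distrib, Finset.prod_pow_eq_pow_sum]
        ring
      _ = _ := by
        rw [prod_sum_neg_one_pow_mul_choose_mul_half_sub_pow s k hsum]
        split_ifs with hks
        · subst hks
          rw [← Nat.multinomial_spec Finset.univ k]
          push_cast
          ring
        · simp
  simp_rw [Finset.sum_pow_eq_sum_piAntidiag, Finset.mul_sum (Finset.univ.piAntidiag _)]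
  rw [Finset.sum_comm, Finset.sum_congr rfl key, Finset.sum_ite_eq', if_pos (by simp),
    one_div, inv_mul_cancel_left₀ (by positivity)]
end

section
/- Gaussian correlation inequality: Let n = n₁ + n₂ and let X = (X_1, …, X_n) be an n-dimensional centered Gaussian random vector (its law is the multivariate Gaussian measure on ℝⁿ with mean 0 and some positive semidefinite covariance matrix). Then for all t_1, …, t_n > 0, P(|X_1| ≤ t_1, …, |X_n| ≤ t_n) ≥ P(|X_1| ≤ t_1, …, |X_{n₁}| ≤ t_{n₁}) · P(|X_{n₁+1}| ≤ t_{n₁+1}, …, |X_n| ≤ t_n). -/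
open MeasureTheory ProbabilityTheory

/-- `X : Ω → Fin n → ℝ` is a centered Gaussian random vector: there is a positive
semidefinite covariance matrix `Σ` such that every linear combination of the
coordinates of `X` is a centered real Gaussian with variance `cᵀ Σ c`. -/
def IsCenteredGaussianVector {Ω : Type*} [MeasurableSpace Ω] (P : Measure Ω)
    {n : ℕ} (X : Ω → Fin n → ℝ) : Prop :=
  (∀ i, Measurable fun ω => X ω i) ∧
    ∃ S : Matrix (Fin n) (Fin n) ℝ, S.PosSemidef ∧
      ∀ c : Fin n → ℝ,
        P.map (fun ω => ∑ i, c i * X ω i)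
          = gaussianReal 0 (Real.toNNReal (∑ i, ∑ j, c i * S i j * c j))

section GaussianCorrelation

lemma integral_exp_neg_sq_gaussianReal {d : ℝ} (hd : 0 ≤ d) :
    ∫ x, Real.exp (-(d * x ^ 2) / 2) ∂gaussianReal 0 1 = (√(1 + d))⁻¹ := by
  have key : ∀ x : ℝ, gaussianPDFReal 0 1 x • Real.exp (-(d * x ^ 2) / 2)
      = (√(2 * Real.pi))⁻¹ * Real.exp (-((1 + d) / 2) * x ^ 2) := fun x ↦ by
    simp only [gaussianPDFReal, NNReal.coe_one, mul_one, sub_zero, smul_eq_mul]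
    rw [mul_assoc, ← Real.exp_add]
    ring_nf
  have h1 : (0 : ℝ) < 1 + d := by linarith
  rw [integral_gaussianReal_eq_integral_smul one_ne_zero]
  simp_rw [key]
  rw [integral_const_mul, integral_gaussian, ← Real.sqrt_inv, ← Real.sqrt_inv,
    ← Real.sqrt_mul (by positivity)]
  congr 1
  field_simp

variable {ι : Type*} [Fintype ι] [DecidableEq ι]

lemma Matrix.IsHermitian.det_one_add {M : Matrix ι ι ℝ} (hM : M.IsHermitian) :
    (1 + M).det = ∏ i, (1 + hM.eigenvalues i) := by
  have h := Matrix.eval_charpoly M (-1)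
  rw [hM.charpoly_eq, Polynomial.eval_prod] at h
  have h2 : (Matrix.scalar ι (-1 : ℝ) - M) = -(1 + M) := by
    rw [map_neg, map_one]; abel
  rw [h2, Matrix.det_neg] at h
  simp only [Polynomial.eval_sub, Polynomial.eval_X, Polynomial.eval_C,
    RCLike.ofReal_real_eq_id, id] at h
  have h3 : ∏ i, (-1 - hM.eigenvalues i) = (-1) ^ Fintype.card ι * ∏ i, (1 + hM.eigenvalues i) := by
    rw [Fintype.card, ← Finset.prod_const, ← Finset.prod_mul_distrib]
    exact Finset.prod_congr rfl fun i _ ↦ by ring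
  rw [h3] at h
  exact (mul_left_cancel₀ (pow_ne_zero _ (by norm_num)) h).symm

lemma Matrix.PosSemidef.integral_exp_neg_quadratic {M : Matrix ι ι ℝ} (hM : M.PosSemidef) :
    ∫ x, Real.exp (-(x.ofLp ⬝ᵥ M.mulVec x.ofLp) / 2) ∂stdGaussian (EuclideanSpace ℝ ι)
      = (√(1 + M).det)⁻¹ := by
  have hH := hM.isHermitian
  have key : ∀ y : ι → ℝ, (∑ i, y i • hH.eigenvectorBasis i).ofLp ⬝ᵥ
      M.mulVec (∑ i, y i • hH.eigenvectorBasis i).ofLp = ∑ i, hH.eigenvalues i * y i ^ 2 := fun y ↦ by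
    have h1 : M.mulVec (∑ i, y i • hH.eigenvectorBasis i).ofLp
        = (∑ i, (hH.eigenvalues i * y i) • hH.eigenvectorBasis i).ofLp := by
      simp only [WithLp.ofLp_sum, WithLp.ofLp_smul, Matrix.mulVec_sum, Matrix.mulVec_smul,
        hH.mulVec_eigenvectorBasis, smul_smul, mul_comm]
    rw [h1, dotProduct_comm]
    have h2 := hH.eigenvectorBasis.orthonormal.inner_sum y (fun i ↦ hH.eigenvalues i * y i)
      Finset.univ
    rw [EuclideanSpace.inner_eq_star_dotProduct] at h2
    simp only [star_trivial, conj_trivial] at h2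
    rw [h2]
    exact Finset.sum_congr rfl fun i _ ↦ by ring
  rw [stdGaussian_eq_map_pi_orthonormalBasis hH.eigenvectorBasis,
    integral_map (Measurable.aemeasurable (by fun_prop)) (Measurable.aestronglyMeasurable
      (by unfold Matrix.mulVec dotProduct; fun_prop))]
  simp_rw [key, ← Finset.sum_neg_distrib, Finset.sum_div, Real.exp_sum]
  rw [integral_fintype_prod_eq_prod (f := fun i x ↦ Real.exp (-(hH.eigenvalues i * x ^ 2) / 2)),
    hH.det_one_add, Real.sqrt_prod _ (fun i _ ↦ by linarith [hM.eigenvalues_nonneg i]),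
    ← Finset.prod_inv_distrib]
  exact Finset.prod_congr rfl fun i _ ↦ integral_exp_neg_sq_gaussianReal (hM.eigenvalues_nonneg i)

/-- The joint Laplace transform of the halved squared coordinates of a measure `μ` on `ι → ℝ`
is that of a centered Gaussian measure with covariance matrix `C`. -/
def HasGaussianSqLaplace (μ : Measure (ι → ℝ)) (C : Matrix ι ι ℝ) : Prop :=
  ∀ l : ι → ℝ, 0 ≤ l →
    ∫ x, Real.exp (-(∑ i, l i * x i ^ 2) / 2) ∂μ = (√(1 + Matrix.diagonal l * C).det)⁻¹

open scoped MatrixOrder in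
lemma hasGaussianSqLaplace_multivariateGaussian {C : Matrix ι ι ℝ} (hC : C.PosSemidef) :
    HasGaussianSqLaplace ((multivariateGaussian 0 C).map WithLp.ofLp) C := by
  intro l hl
  set R := CFC.sqrt C
  have hRR : R * R = C := CFC.sqrt_mul_sqrt_self C hC.nonneg
  have hRs : R.transpose = R := by
    have := (CFC.sqrt_nonneg C).isSelfAdjoint
    simpa [IsSelfAdjoint, Matrix.star_eq_conjTranspose] using this
  have hM : (R * Matrix.diagonal l * R).PosSemidef := by
    have := (Matrix.PosSemidef.diagonal (d := l) hl).conjTranspose_mul_mul_same R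
    simpa [hRs] using this
  have hdet : (1 + Matrix.diagonal l * C).det = (1 + R * Matrix.diagonal l * R).det := by
    rw [← hRR, ← mul_assoc, Matrix.det_one_add_mul_comm, ← mul_assoc]
  rw [hdet, ← hM.integral_exp_neg_quadratic, multivariateGaussian,
    Measure.map_map (by fun_prop) (by fun_prop),
    integral_map (Measurable.aemeasurable (by fun_prop))
      (Measurable.aestronglyMeasurable (by fun_prop))]
  congr with x
  congr 3
  simp only [Function.comp, zero_add, Matrix.ofLp_toEuclideanCLM]
  rw [← Matrix.mulVec_mulVec, ← Matrix.mulVec_mulVec, Matrix.dotProduct_mulVec,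
    ← Matrix.mulVec_transpose, hRs]
  simp only [dotProduct, Matrix.mulVec_diagonal]
  exact Finset.sum_congr rfl fun i _ ↦ by ring

/-- The symmetric matrix obtained from `C` by multiplying by `τ` the entries which couple the
indices satisfying `p` with the others. -/
def scaleCross (C : Matrix ι ι ℝ) (p : ι → Prop) [DecidablePred p] (τ : ℝ) : Matrix ι ι ℝ :=
  Matrix.of fun i j ↦ (if p i ↔ p j then 1 else τ) * C i j

section ScaleCross

variable (C : Matrix ι ι ℝ) (p : ι → Prop) [DecidablePred p]

omit [Fintype ι] [DecidableEq ι] in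
lemma scaleCross_one : scaleCross C p 1 = C := by
  ext i j; simp [scaleCross]

omit [Fintype ι] [DecidableEq ι] in
lemma scaleCross_combo {a b : ℝ} (hab : a + b = 1) (σ τ : ℝ) :
    scaleCross C p (a * σ + b * τ) = a • scaleCross C p σ + b • scaleCross C p τ := by
  ext i j
  simp only [scaleCross, Matrix.of_apply, Matrix.add_apply, Matrix.smul_apply, smul_eq_mul]
  split_ifs
  · linear_combination (-C i j) * hab
  · ring

lemma scaleCross_neg (τ : ℝ) :
    scaleCross C p (-τ) = Matrix.diagonal (fun i ↦ if p i then 1 else -1) * scaleCross C p τ *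
      Matrix.diagonal (fun i ↦ if p i then 1 else -1) := by
  ext i j
  simp only [scaleCross, Matrix.of_apply, Matrix.mul_diagonal, Matrix.diagonal_mul]
  by_cases hi : p i <;> by_cases hj : p j <;> simp [hi, hj]

variable {C}

lemma Matrix.PosSemidef.scaleCross_neg {τ : ℝ} (h : (scaleCross C p τ).PosSemidef) :
    (scaleCross C p (-τ)).PosSemidef := by
  rw [_root_.scaleCross_neg]
  simpa using h.conjTranspose_mul_mul_same (Matrix.diagonal (fun i ↦ if p i then (1 : ℝ) else -1))

lemma Matrix.PosSemidef.scaleCross (hC : C.PosSemidef) {τ : ℝ} (h0 : 0 ≤ τ) (h1 : τ ≤ 1) :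
    (scaleCross C p τ).PosSemidef := by
  have h : τ = (1 + τ) / 2 * 1 + (1 - τ) / 2 * (-1) := by ring
  rw [h, scaleCross_combo C p (by ring)]
  rw [← scaleCross_one C p] at hC
  exact (hC.smul (by linarith)).add ((hC.scaleCross_neg p).smul (by linarith))

lemma det_one_add_diagonal_mul_scaleCross_neg (l : ι → ℝ) (τ : ℝ) :
    (1 + Matrix.diagonal l * scaleCross C p (-τ)).det
      = (1 + Matrix.diagonal l * scaleCross C p τ).det := by
  rw [scaleCross_neg, ← mul_assoc, Matrix.det_one_add_mul_comm, ← mul_assoc, ← mul_assoc,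
    Matrix.diagonal_mul_diagonal, Matrix.diagonal_mul_diagonal]
  congr 4
  ext i
  split_ifs <;> ring

lemma diagonal_eq_sqrt_mul_sqrt {l : ι → ℝ} (hl : 0 ≤ l) :
    Matrix.diagonal l = Matrix.diagonal (fun i ↦ √(l i)) * Matrix.diagonal (fun i ↦ √(l i)) := by
  rw [Matrix.diagonal_mul_diagonal]
  congr with i
  exact (Real.mul_self_sqrt (hl i)).symm

lemma det_one_add_diagonal_mul {l : ι → ℝ} (hl : 0 ≤ l) (A : Matrix ι ι ℝ) :
    (1 + Matrix.diagonal l * A).det = (1 + Matrix.diagonal (fun i ↦ √(l i)) * A *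
      Matrix.diagonal (fun i ↦ √(l i))).det := by
  rw [diagonal_eq_sqrt_mul_sqrt hl, mul_assoc, Matrix.det_one_add_mul_comm]

lemma Matrix.PosSemidef.diagonal_sqrt_mul_mul {A : Matrix ι ι ℝ} (hA : A.PosSemidef) (l : ι → ℝ) :
    (Matrix.diagonal (fun i ↦ √(l i)) * A * Matrix.diagonal (fun i ↦ √(l i))).PosSemidef := by
  simpa using hA.conjTranspose_mul_mul_same (Matrix.diagonal (fun i ↦ √(l i)))

lemma Matrix.PosSemidef.det_one_add_pos {A : Matrix ι ι ℝ} (hA : A.PosSemidef) :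
    0 < (1 + A).det :=
  (Matrix.PosDef.one.add_posSemidef hA).det_pos

lemma Matrix.PosSemidef.det_one_add_diagonal_mul_pos {A : Matrix ι ι ℝ} (hA : A.PosSemidef)
    {l : ι → ℝ} (hl : 0 ≤ l) : 0 < (1 + Matrix.diagonal l * A).det := by
  rw [det_one_add_diagonal_mul hl]
  exact (hA.diagonal_sqrt_mul_mul l).det_one_add_pos

omit [DecidableEq ι] in
lemma Matrix.PosSemidef.integrable_exp_neg_quadratic {M : Matrix ι ι ℝ} (hM : M.PosSemidef) :
    Integrable (fun x : EuclideanSpace ℝ ι ↦ Real.exp (-(x.ofLp ⬝ᵥ M.mulVec x.ofLp) / 2))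
      (stdGaussian (EuclideanSpace ℝ ι)) := by
  refine Integrable.of_bound (C := 1) (Measurable.aestronglyMeasurable
    (by unfold Matrix.mulVec dotProduct; fun_prop)) (ae_of_all _ fun x ↦ ?_)
  rw [Real.norm_of_nonneg (Real.exp_nonneg _), Real.exp_le_one_iff]
  have := hM.dotProduct_mulVec_nonneg x.ofLp
  rw [star_trivial] at this
  linarith

/-- The function `M ↦ det (1 + M) ^ (-1/2)` is convex, since it is a Gaussian average of
exponentials of linear functions of `M`. -/
lemma Matrix.PosSemidef.inv_sqrt_det_one_add_combo_le {M N : Matrix ι ι ℝ} (hM : M.PosSemidef)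
    (hN : N.PosSemidef) {a b : ℝ} (ha : 0 ≤ a) (hb : 0 ≤ b) (hab : a + b = 1) :
    (√(1 + (a • M + b • N)).det)⁻¹ ≤ a * (√(1 + M).det)⁻¹ + b * (√(1 + N).det)⁻¹ := by
  have hMN : (a • M + b • N).PosSemidef := (hM.smul ha).add (hN.smul hb)
  rw [← hM.integral_exp_neg_quadratic, ← hN.integral_exp_neg_quadratic,
    ← hMN.integral_exp_neg_quadratic, ← integral_const_mul, ← integral_const_mul,
    ← integral_add (hM.integrable_exp_neg_quadratic.const_mul a)
      (hN.integrable_exp_neg_quadratic.const_mul b)]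
  refine integral_mono hMN.integrable_exp_neg_quadratic
    ((hM.integrable_exp_neg_quadratic.const_mul a).add
      (hN.integrable_exp_neg_quadratic.const_mul b)) fun x ↦ ?_
  refine le_of_eq_of_le ?_ (convexOn_exp.2 (Set.mem_univ _) (Set.mem_univ _) ha hb hab)
  simp only [Matrix.add_mulVec, Matrix.smul_mulVec, dotProduct_add, dotProduct_smul, smul_eq_mul]
  ring_nf

lemma Matrix.PosSemidef.antitoneOn_det_one_add_scaleCross (hC : C.PosSemidef) {l : ι → ℝ}
    (hl : 0 ≤ l) :
    AntitoneOn (fun τ ↦ (1 + Matrix.diagonal l * _root_.scaleCross C p τ).det)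
      (Set.Icc 0 1) := by
  intro σ hσ τ hτ hστ
  have hτp := hC.scaleCross p hτ.1 hτ.2
  have hτn := hτp.scaleCross_neg p
  have hσp := hC.scaleCross p hσ.1 hσ.2
  have hmem : σ ∈ segment ℝ τ (-τ) := by
    rw [segment_symm, segment_eq_Icc (by linarith [hτ.1])]
    exact ⟨by linarith [hσ.1, hτ.1], hστ⟩
  obtain ⟨a, b, ha, hb, hab, rfl⟩ := hmem
  have hpos := hτp.det_one_add_diagonal_mul_pos hl
  have hpos' := hσp.det_one_add_diagonal_mul_pos hl
  have key := (hτp.diagonal_sqrt_mul_mul l).inv_sqrt_det_one_add_combo_le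
    (hτn.diagonal_sqrt_mul_mul l) ha hb hab
  rw [← det_one_add_diagonal_mul hl, ← det_one_add_diagonal_mul hl,
    det_one_add_diagonal_mul_scaleCross_neg, ← add_mul, hab, one_mul] at key
  have heq : a • (Matrix.diagonal (fun i ↦ √(l i)) * _root_.scaleCross C p τ *
        Matrix.diagonal (fun i ↦ √(l i))) +
      b • (Matrix.diagonal (fun i ↦ √(l i)) * _root_.scaleCross C p (-τ) *
        Matrix.diagonal (fun i ↦ √(l i)))
      = Matrix.diagonal (fun i ↦ √(l i)) * _root_.scaleCross C p (a • τ + b • -τ) *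
        Matrix.diagonal (fun i ↦ √(l i)) := by
    simp only [smul_eq_mul]
    rw [scaleCross_combo C p hab]
    simp only [mul_add, add_mul, Matrix.mul_smul, Matrix.smul_mul]
  rw [heq, ← det_one_add_diagonal_mul hl,
    inv_le_inv₀ (Real.sqrt_pos.2 hpos') (Real.sqrt_pos.2 hpos)] at key
  exact (Real.sqrt_le_sqrt_iff hpos'.le).1 key

end ScaleCross

/-- The determinant of the matrix obtained from the identity matrix by replacing the rows in `s`
by those of `A`; this is the principal minor of `A` on `s`. -/
def rowMinor (s : Finset ι) (A : Matrix ι ι ℝ) : ℝ :=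
  (Matrix.diagonal (fun i ↦ if i ∈ s then 0 else 1) +
    Matrix.diagonal (fun i ↦ if i ∈ s then 1 else 0) * A).det

lemma det_one_add_diagonal_mul_eq_sum (l : ι → ℝ) (A : Matrix ι ι ℝ) :
    (1 + Matrix.diagonal l * A).det = ∑ s : Finset ι, (∏ i ∈ s, l i) * rowMinor s A := by
  rw [add_comm]
  refine (Matrix.detRowAlternating.toMultilinearMap.map_add_univ
    (Matrix.diagonal l * A) (1 : Matrix ι ι ℝ)).trans (Finset.sum_congr rfl fun s _ ↦ ?_)
  have h : ∏ i ∈ s, l i = (Matrix.diagonal (fun i ↦ if i ∈ s then l i else 1)).det := by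
    simp [Matrix.det_diagonal]
  rw [rowMinor, h, ← Matrix.det_mul]
  change Matrix.det _ = _
  congr 1
  ext i j
  by_cases hi : i ∈ s <;>
    simp [Finset.piecewise, hi, Matrix.diagonal_mul, Matrix.add_apply, Matrix.diagonal_apply,
      Matrix.one_apply]

open Topology Filter in
lemma Matrix.PosSemidef.antitoneOn_rowMinor_scaleCross {C : Matrix ι ι ℝ} (p : ι → Prop)
    [DecidablePred p] (hC : C.PosSemidef) (s : Finset ι) :
    AntitoneOn (fun τ ↦ rowMinor s (_root_.scaleCross C p τ)) (Set.Icc 0 1) := by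
  intro σ hσ τ hτ hστ
  let E : Matrix ι ι ℝ → ℝ → ℝ := fun A u ↦ (Matrix.diagonal (fun i ↦ if i ∈ s then u else 1) +
    Matrix.diagonal (fun i ↦ if i ∈ s then 1 else 0) * A).det
  have hE : ∀ A, Tendsto (E A) (𝓝[>] 0) (𝓝 (rowMinor s A)) := fun A ↦ by
    have : Continuous (E A) := by
      refine Continuous.matrix_det ?_
      refine Continuous.add (Continuous.matrix_diagonal (continuous_pi fun i ↦ ?_))
        continuous_const
      split_ifs <;> fun_prop
    exact (this.tendsto 0).mono_left nhdsWithin_le_nhds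
  refine le_of_tendsto_of_tendsto (hE _) (hE _) ?_
  filter_upwards [self_mem_nhdsWithin] with u hu
  have hu : (0 : ℝ) < u := hu
  have key : ∀ A, E A u = (∏ i, if i ∈ s then u else 1) *
      (1 + Matrix.diagonal (fun i ↦ if i ∈ s then u⁻¹ else 0) * A).det := fun A ↦ by
    rw [← Matrix.det_diagonal, ← Matrix.det_mul, mul_add, mul_one, ← mul_assoc,
      Matrix.diagonal_mul_diagonal]
    simp only [E]
    congr 4
    ext i
    split_ifs <;> simp [hu.ne']
  rw [key, key]
  refine mul_le_mul_of_nonneg_left (hC.antitoneOn_det_one_add_scaleCross p (fun i ↦ ?_)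
    hσ hτ hστ) (Finset.prod_nonneg fun i _ ↦ ?_)
  · simp only [Pi.zero_apply]
    split_ifs <;> positivity
  · split_ifs <;> positivity

lemma differentiable_rowMinor_scaleCross (C : Matrix ι ι ℝ) (p : ι → Prop)
    [DecidablePred p] (s : Finset ι) :
    Differentiable ℝ (fun τ ↦ rowMinor s (scaleCross C p τ)) := by
  simp only [rowMinor, Matrix.det_apply]
  have h : ∀ i j, Differentiable ℝ (fun τ ↦ scaleCross C p τ i j) := fun i j ↦ by
    simp only [scaleCross, Matrix.of_apply]
    split_ifs <;> fun_prop
  refine Differentiable.fun_sum fun g _ ↦ Differentiable.const_smul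
    (Differentiable.fun_finsetProd fun i _ ↦ ?_) _
  simp only [Matrix.add_apply, Matrix.diagonal_mul]
  fun_prop

section Products

variable {κ : Type*} [Fintype κ]

omit [DecidableEq ι] in
lemma integrable_exp_neg_sum {Ω : Type*} [MeasurableSpace Ω] (ν : Measure Ω)
    [IsProbabilityMeasure ν] {W : Ω → ι → ℝ} (hW : Measurable W) (hW0 : ∀ ω, 0 ≤ W ω)
    {l : ι → ℝ} (hl : 0 ≤ l) :
    Integrable (fun ω ↦ Real.exp (-∑ i, l i * W ω i)) ν := by
  refine Integrable.of_bound (C := 1) (Measurable.aestronglyMeasurable (by fun_prop))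
    (ae_of_all _ fun ω ↦ ?_)
  rw [Real.norm_of_nonneg (Real.exp_nonneg _), Real.exp_le_one_iff, neg_nonpos]
  exact Finset.sum_nonneg fun i _ ↦ mul_nonneg (hl i) (hW0 ω i)

lemma integral_prod_sum_exp {Ω : Type*} [MeasurableSpace Ω] (ν : Measure Ω)
    [IsProbabilityMeasure ν] {W : Ω → ι → ℝ} (hW : Measurable W) (hW0 : ∀ ω, 0 ≤ W ω)
    (b l : ι → κ → ℝ) (hl : ∀ i, 0 ≤ l i) :
    ∫ ω, ∏ i, ∑ j, b i j * Real.exp (-(l i j * W ω i)) ∂ν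
      = ∑ k : ι → κ, (∏ i, b i (k i)) * ∫ ω, Real.exp (-∑ i, l i (k i) * W ω i) ∂ν := by
  have h : ∀ ω, ∏ i, ∑ j, b i j * Real.exp (-(l i j * W ω i))
      = ∑ k : ι → κ, (∏ i, b i (k i)) * Real.exp (-∑ i, l i (k i) * W ω i) := fun ω ↦ by
    rw [Finset.prod_univ_sum, Fintype.piFinset_univ]
    refine Finset.sum_congr rfl fun k _ ↦ ?_
    rw [Finset.prod_mul_distrib, ← Real.exp_sum, Finset.sum_neg_distrib]
  simp_rw [h]
  rw [integral_finsetSum]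
  · simp_rw [integral_const_mul]
  · exact fun k _ ↦ (integrable_exp_neg_sum ν hW hW0 fun i ↦ hl i (k i)).const_mul _

lemma HasGaussianSqLaplace.integral_exp_neg_sum {μ : Measure (ι → ℝ)} {C : Matrix ι ι ℝ}
    (hμ : HasGaussianSqLaplace μ C) {l : ι → ℝ} (hl : 0 ≤ l) :
    ∫ x, Real.exp (-∑ i, l i * (x i ^ 2 / 2)) ∂μ
      = (√(1 + Matrix.diagonal l * C).det)⁻¹ := by
  rw [← hμ l hl]
  simp only [Finset.sum_div, neg_div, mul_div_assoc]

/-- The expectation of `∏ i, ∑ j, b i j * exp (-(l i j * X i ^ 2 / 2))` for a centered Gaussian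
vector `X` with covariance matrix `C`. -/
noncomputable def gaussianExpSum (b l : ι → κ → ℝ) (C : Matrix ι ι ℝ) : ℝ :=
  ∑ k : ι → κ, (∏ i, b i (k i)) * (√(1 + Matrix.diagonal (fun i ↦ l i (k i)) * C).det)⁻¹

lemma HasGaussianSqLaplace.integral_prod_sum_exp {μ : Measure (ι → ℝ)} [IsProbabilityMeasure μ]
    {C : Matrix ι ι ℝ} (hμ : HasGaussianSqLaplace μ C) (b l : ι → κ → ℝ) (hl : ∀ i, 0 ≤ l i) :
    ∫ x, ∏ i, ∑ j, b i j * Real.exp (-(l i j * (x i ^ 2 / 2))) ∂μ = gaussianExpSum b l C := by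
  rw [_root_.integral_prod_sum_exp μ (W := fun x i ↦ x i ^ 2 / 2) (by fun_prop)
    (fun x i ↦ by simp only [Pi.zero_apply]; positivity) b l hl]
  refine Finset.sum_congr rfl fun k _ ↦ ?_
  rw [hμ.integral_exp_neg_sum fun i ↦ hl i (k i)]

lemma HasGaussianSqLaplace.integral_prod_sum_exp_cube {μ : Measure (ι → ℝ)}
    [IsProbabilityMeasure μ] {C : Matrix ι ι ℝ} (hμ : HasGaussianSqLaplace μ C)
    (b l : ι → κ → ℝ) (hl : ∀ i, 0 ≤ l i) :
    ∫ x, ∏ i, ∑ j, b i j * Real.exp (-(l i j *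
        (x.1 i ^ 2 / 2 + (x.2.1 i ^ 2 / 2 + x.2.2 i ^ 2 / 2)))) ∂(μ.prod (μ.prod μ))
      = ∑ k : ι → κ, (∏ i, b i (k i)) *
        (√(1 + Matrix.diagonal (fun i ↦ l i (k i)) * C).det)⁻¹ ^ 3 := by
  rw [_root_.integral_prod_sum_exp (μ.prod (μ.prod μ))
    (W := fun x i ↦ x.1 i ^ 2 / 2 + (x.2.1 i ^ 2 / 2 + x.2.2 i ^ 2 / 2)) (by fun_prop)
    (fun x i ↦ by simp only [Pi.zero_apply]; positivity) b l hl]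
  refine Finset.sum_congr rfl fun k _ ↦ ?_
  simp_rw [mul_add, Finset.sum_add_distrib, neg_add, Real.exp_add]
  rw [integral_prod_mul (fun x : ι → ℝ ↦ Real.exp (-∑ i, l i (k i) * (x i ^ 2 / 2)))
      (fun y : (ι → ℝ) × (ι → ℝ) ↦ Real.exp (-∑ i, l i (k i) * (y.1 i ^ 2 / 2)) *
        Real.exp (-∑ i, l i (k i) * (y.2 i ^ 2 / 2))),
    integral_prod_mul (fun x : ι → ℝ ↦ Real.exp (-∑ i, l i (k i) * (x i ^ 2 / 2)))
      (fun x : ι → ℝ ↦ Real.exp (-∑ i, l i (k i) * (x i ^ 2 / 2))),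
    hμ.integral_exp_neg_sum fun i ↦ hl i (k i)]
  ring

lemma det_one_add_diagonal_mul_scaleCross_zero (C : Matrix ι ι ℝ) (p : ι → Prop)
    [DecidablePred p] (l : ι → ℝ) :
    (1 + Matrix.diagonal l * scaleCross C p 0).det
      = (1 + Matrix.diagonal (fun i ↦ if p i then l i else 0) * C).det *
        (1 + Matrix.diagonal (fun i ↦ if p i then 0 else l i) * C).det := by
  have h : ∀ (q : ι → Prop) [DecidablePred q] (A : Matrix ι ι ℝ),
      (1 + Matrix.diagonal (fun i ↦ if q i then l i else 0) * A).det
        = (1 + Matrix.diagonal (fun i ↦ if q i then l i else 0) * A *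
          Matrix.diagonal (fun i ↦ if q i then 1 else 0)).det := fun q _ A ↦ by
    symm
    rw [Matrix.det_one_add_mul_comm, ← mul_assoc, Matrix.diagonal_mul_diagonal]
    congr 4
    ext i
    split_ifs <;> simp
  have h' : (fun i ↦ if p i then 0 else l i) = fun i ↦ if ¬ p i then l i else 0 := by
    ext i; by_cases hi : p i <;> simp [hi]
  rw [h', h p, h (fun i ↦ ¬ p i)]
  have h1 : ∀ (q : ι → Prop) [DecidablePred q], (∀ i j, (q i ↔ q j) ↔ (p i ↔ p j)) →
      Matrix.diagonal (fun i ↦ if q i then l i else 0) * C *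
          Matrix.diagonal (fun i ↦ if q i then 1 else 0)
        = Matrix.diagonal (fun i ↦ if q i then l i else 0) * scaleCross C p 0 := by
    intro q _ hq
    ext i j
    simp only [Matrix.mul_diagonal, Matrix.diagonal_mul, scaleCross, Matrix.of_apply, ← hq]
    by_cases hi : q i <;> by_cases hj : q j <;> simp [hi, hj]
  rw [h1 p fun _ _ ↦ Iff.rfl, h1 (fun i ↦ ¬ p i) fun _ _ ↦ not_iff_not, ← Matrix.det_mul]
  congr 1
  have h2 : Matrix.diagonal l = Matrix.diagonal (fun i ↦ if p i then l i else 0) +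
      Matrix.diagonal (fun i ↦ if ¬ p i then l i else 0) := by
    rw [Matrix.diagonal_add]
    congr with i
    by_cases hi : p i <;> simp [hi]
  have h3 : Matrix.diagonal (fun i ↦ if p i then l i else 0) * scaleCross C p 0 *
      (Matrix.diagonal (fun i ↦ if ¬ p i then l i else 0) * scaleCross C p 0) = 0 := by
    rw [← mul_assoc]
    convert zero_mul _
    ext i j
    simp only [Matrix.mul_diagonal, Matrix.diagonal_mul, scaleCross, Matrix.of_apply,
      Matrix.zero_apply]
    by_cases hi : p i <;> by_cases hj : p j <;> simp [hi, hj]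
  rw [add_mul, one_mul, mul_add, mul_one, h3, h2, add_mul]
  abel

lemma HasGaussianSqLaplace.integral_prod_sum_exp_ite {μ : Measure (ι → ℝ)}
    [IsProbabilityMeasure μ] {C : Matrix ι ι ℝ} (hC : C.PosSemidef) (hμ : HasGaussianSqLaplace μ C)
    (p : ι → Prop) [DecidablePred p] (b l : ι → κ → ℝ) (hl : ∀ i, 0 ≤ l i) :
    ∫ x, ∏ i, ∑ j, b i j * Real.exp (-(l i j * ((if p i then x.1 i else x.2 i) ^ 2 / 2)))
        ∂(μ.prod μ)
      = gaussianExpSum b l (scaleCross C p 0) := by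
  have hmeas : Measurable (fun (x : (ι → ℝ) × (ι → ℝ)) i ↦
      (if p i then x.1 i else x.2 i) ^ 2 / 2) := by
    refine measurable_pi_lambda _ fun i ↦ ?_
    split_ifs <;> fun_prop
  rw [_root_.integral_prod_sum_exp (μ.prod μ)
    (W := fun x i ↦ (if p i then x.1 i else x.2 i) ^ 2 / 2) hmeas
    (fun x i ↦ by simp only [Pi.zero_apply]; positivity) b l hl]
  refine Finset.sum_congr rfl fun k _ ↦ ?_
  have hs : ∀ x : (ι → ℝ) × (ι → ℝ),
      Real.exp (-∑ i, l i (k i) * ((if p i then x.1 i else x.2 i) ^ 2 / 2))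
        = Real.exp (-∑ i, (if p i then l i (k i) else 0) * (x.1 i ^ 2 / 2)) *
          Real.exp (-∑ i, (if p i then 0 else l i (k i)) * (x.2 i ^ 2 / 2)) := fun x ↦ by
    rw [← Real.exp_add, ← neg_add, ← Finset.sum_add_distrib]
    congr 2
    refine Finset.sum_congr rfl fun i _ ↦ ?_
    split_ifs <;> simp
  have h1 : (0 : ι → ℝ) ≤ fun i ↦ if p i then l i (k i) else 0 := fun i ↦ by
    have := hl i (k i)
    simp only [Pi.zero_apply] at this ⊢
    split_ifs
    exacts [this, le_rfl]
  have h2 : (0 : ι → ℝ) ≤ fun i ↦ if p i then 0 else l i (k i) := fun i ↦ by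
    have := hl i (k i)
    simp only [Pi.zero_apply] at this ⊢
    split_ifs
    exacts [le_rfl, this]
  simp_rw [hs]
  rw [integral_prod_mul
      (fun x : ι → ℝ ↦ Real.exp (-∑ i, (if p i then l i (k i) else 0) * (x i ^ 2 / 2)))
      (fun x : ι → ℝ ↦ Real.exp (-∑ i, (if p i then 0 else l i (k i)) * (x i ^ 2 / 2))),
    hμ.integral_exp_neg_sum h1, hμ.integral_exp_neg_sum h2,
    det_one_add_diagonal_mul_scaleCross_zero,
    Real.sqrt_mul (hC.det_one_add_diagonal_mul_pos h1).le, mul_inv]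

lemma Matrix.PosSemidef.hasDerivAt_gaussianExpSum {C : Matrix ι ι ℝ} (p : ι → Prop)
    [DecidablePred p] (b l : ι → κ → ℝ) (hl : ∀ i, 0 ≤ l i) {τ : ℝ}
    (hC : (_root_.scaleCross C p τ).PosSemidef) :
    HasDerivAt (fun τ ↦ gaussianExpSum b l (_root_.scaleCross C p τ))
      (∑ s : Finset ι, (-(deriv (fun τ ↦ rowMinor s (_root_.scaleCross C p τ)) τ) / 2) *
        ∑ k : ι → κ, (∏ i, (b i (k i) * if i ∈ s then l i (k i) else 1)) *
        (√(1 + Matrix.diagonal (fun i ↦ l i (k i)) * _root_.scaleCross C p τ).det)⁻¹ ^ 3) τ := by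
  have hD : ∀ k : ι → κ, HasDerivAt (fun τ ↦
      (√(1 + Matrix.diagonal (fun i ↦ l i (k i)) * _root_.scaleCross C p τ).det)⁻¹)
      (-(∑ s : Finset ι, (∏ i ∈ s, l i (k i)) *
        deriv (fun τ ↦ rowMinor s (_root_.scaleCross C p τ)) τ) / 2 *
        (√(1 + Matrix.diagonal (fun i ↦ l i (k i)) * _root_.scaleCross C p τ).det)⁻¹ ^ 3) τ := by
    intro k
    have hpos := hC.det_one_add_diagonal_mul_pos (l := fun i ↦ l i (k i)) fun i ↦ hl i (k i)
    have h1 : HasDerivAt (fun τ ↦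
        (1 + Matrix.diagonal (fun i ↦ l i (k i)) * _root_.scaleCross C p τ).det)
        (∑ s : Finset ι, (∏ i ∈ s, l i (k i)) *
          deriv (fun τ ↦ rowMinor s (_root_.scaleCross C p τ)) τ) τ := by
      simp_rw [det_one_add_diagonal_mul_eq_sum]
      exact HasDerivAt.fun_sum fun s _ ↦
        ((differentiable_rowMinor_scaleCross C p s τ).hasDerivAt).const_mul _
    have h2 := (h1.sqrt hpos.ne').inv (Real.sqrt_pos.2 hpos).ne'
    have hne := (Real.sqrt_pos.2 hpos).ne'
    refine h2.congr_deriv ?_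
    field_simp
  refine (HasDerivAt.fun_sum fun k _ ↦ (hD k).const_mul (∏ i, b i (k i))).congr_deriv ?_
  simp_rw [Finset.mul_sum]
  rw [Finset.sum_comm]
  refine Finset.sum_congr rfl fun k _ ↦ ?_
  rw [← Finset.sum_neg_distrib, Finset.sum_div, Finset.sum_mul, Finset.mul_sum]
  refine Finset.sum_congr rfl fun s _ ↦ ?_
  rw [Finset.prod_mul_distrib, Finset.prod_ite_mem, Finset.univ_inter]
  ring

lemma Matrix.PosSemidef.gaussianExpSum_scaleCross_zero_le {C : Matrix ι ι ℝ} (hC : C.PosSemidef)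
    (p : ι → Prop) [DecidablePred p] (b l : ι → κ → ℝ) (hl : ∀ i, 0 ≤ l i)
    (hb : ∀ i, ∀ w, 0 ≤ w → 0 ≤ ∑ j, b i j * Real.exp (-(l i j * w)))
    (hbl : ∀ i, ∀ w, 0 ≤ w → 0 ≤ ∑ j, b i j * l i j * Real.exp (-(l i j * w))) :
    gaussianExpSum b l (_root_.scaleCross C p 0) ≤ gaussianExpSum b l C := by
  have hd : ∀ τ ∈ Set.Icc (0 : ℝ) 1, _ := fun τ hτ ↦
    (hC.scaleCross p hτ.1 hτ.2).hasDerivAt_gaussianExpSum p b l hl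
  have hmono : MonotoneOn (fun τ ↦ gaussianExpSum b l (_root_.scaleCross C p τ))
      (Set.Icc 0 1) := by
    refine monotoneOn_of_deriv_nonneg (convex_Icc 0 1)
      (fun τ hτ ↦ (hd τ hτ).continuousAt.continuousWithinAt)
      (fun τ hτ ↦ (hd τ (interior_subset hτ)).differentiableAt.differentiableWithinAt)
      fun τ hτ ↦ ?_
    rw [(hd τ (interior_subset hτ)).deriv]
    have hmem : Set.Icc (0 : ℝ) 1 ∈ nhds τ := mem_interior_iff_mem_nhds.1 hτ
    have hτ := interior_subset hτ
    refine Finset.sum_nonneg fun s _ ↦ mul_nonneg ?_ ?_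
    · have : deriv (fun τ ↦ rowMinor s (_root_.scaleCross C p τ)) τ ≤ 0 := by
        rw [← derivWithin_of_mem_nhds hmem]
        exact (hC.antitoneOn_rowMinor_scaleCross p s).derivWithin_nonpos
      linarith
    · have : IsProbabilityMeasure ((multivariateGaussian 0 (_root_.scaleCross C p τ)).map
          (WithLp.ofLp (p := 2) (V := ι → ℝ))) :=
        Measure.isProbabilityMeasure_map (Measurable.aemeasurable (by fun_prop))
      rw [← (hasGaussianSqLaplace_multivariateGaussian
        (hC.scaleCross p hτ.1 hτ.2)).integral_prod_sum_exp_cube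
        (fun i j ↦ b i j * if i ∈ s then l i j else 1) l hl]
      refine integral_nonneg fun x ↦ Finset.prod_nonneg fun i _ ↦ ?_
      have hw : 0 ≤ x.1 i ^ 2 / 2 + (x.2.1 i ^ 2 / 2 + x.2.2 i ^ 2 / 2) := by positivity
      split_ifs
      · exact hbl i _ hw
      · simpa using hb i _ hw
  have := hmono (Set.left_mem_Icc.2 zero_le_one) (Set.right_mem_Icc.2 zero_le_one) zero_le_one
  simpa only [scaleCross_one] using this

end Products

section Limit

open Filter Topology Polynomial

lemma HasGaussianSqLaplace.integral_prod_eval_le {μ : Measure (ι → ℝ)} [IsProbabilityMeasure μ]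
    {C : Matrix ι ι ℝ} (hC : C.PosSemidef) (hμ : HasGaussianSqLaplace μ C)
    (p : ι → Prop) [DecidablePred p] {c : ι → ℝ} (hc : 0 ≤ c) {q : ℝ[X]}
    (hq : ∀ y ∈ Set.Icc (0 : ℝ) 1, 0 ≤ q.eval y)
    (hq' : ∀ y ∈ Set.Icc (0 : ℝ) 1, 0 ≤ q.derivative.eval y) :
    ∫ x, ∏ i, q.eval (Real.exp (-(c i * ((if p i then x.1 i else x.2 i) ^ 2 / 2)))) ∂(μ.prod μ)
      ≤ ∫ x, ∏ i, q.eval (Real.exp (-(c i * (x i ^ 2 / 2)))) ∂μ := by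
  let b : ι → Fin (q.natDegree + 1) → ℝ := fun _ j ↦ q.coeff j
  let l : ι → Fin (q.natDegree + 1) → ℝ := fun i j ↦ c i * (j : ℕ)
  have hl : ∀ i, 0 ≤ l i := fun i j ↦ mul_nonneg (hc i) (Nat.cast_nonneg _)
  have hexp : ∀ (i : ι) (w : ℝ) (j : ℕ),
      Real.exp (-(c i * j * w)) = Real.exp (-(c i * w)) ^ j := fun i w j ↦ by
    rw [← Real.exp_nat_mul]
    ring_nf
  have heval : ∀ (i : ι) (w : ℝ), ∑ j, b i j * Real.exp (-(l i j * w))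
      = q.eval (Real.exp (-(c i * w))) := fun i w ↦ by
    rw [Polynomial.eval_eq_sum_range, ← Fin.sum_univ_eq_sum_range
      (fun j ↦ q.coeff j * Real.exp (-(c i * w)) ^ j)]
    simp only [b, l, hexp]
  have hderiv : ∀ (i : ι) (w : ℝ), ∑ j, b i j * l i j * Real.exp (-(l i j * w))
      = c i * (Real.exp (-(c i * w)) * q.derivative.eval (Real.exp (-(c i * w)))) := fun i w ↦ by
    have hdeg : (X * q.derivative).natDegree < q.natDegree + 1 := by
      rcases Nat.eq_zero_or_pos q.natDegree with h | h
      · simp [Polynomial.derivative_of_natDegree_zero h]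
      · refine Nat.lt_succ_of_le (Polynomial.natDegree_mul_le.trans ?_)
        have := Polynomial.natDegree_derivative_lt h.ne'
        rw [Polynomial.natDegree_X]
        omega
    have hcoeff : ∀ j : ℕ, (X * q.derivative).coeff j = q.coeff j * j := fun j ↦ by
      cases j with
      | zero => simp
      | succ j => simp [Polynomial.coeff_X_mul, Polynomial.coeff_derivative]
    have hmul : Real.exp (-(c i * w)) * q.derivative.eval (Real.exp (-(c i * w)))
        = (X * q.derivative).eval (Real.exp (-(c i * w))) := by simp
    rw [hmul, Polynomial.eval_eq_sum_range' hdeg]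
    simp_rw [hcoeff]
    rw [← Fin.sum_univ_eq_sum_range
      (fun j : ℕ ↦ q.coeff j * (j : ℝ) * Real.exp (-(c i * w)) ^ j), Finset.mul_sum]
    refine Finset.sum_congr rfl fun j _ ↦ ?_
    simp only [b, l, hexp]
    ring
  have hmem : ∀ (i : ι) (w : ℝ), 0 ≤ w → Real.exp (-(c i * w)) ∈ Set.Icc (0 : ℝ) 1 :=
    fun i w hw ↦ ⟨Real.exp_nonneg _, Real.exp_le_one_iff.2 (neg_nonpos.2 (mul_nonneg (hc i) hw))⟩
  have h1 := hμ.integral_prod_sum_exp_ite hC p b l hl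
  have h2 := hμ.integral_prod_sum_exp b l hl
  simp only [heval] at h1 h2
  rw [h1, h2]
  refine hC.gaussianExpSum_scaleCross_zero_le p b l hl (fun i w hw ↦ ?_) fun i w hw ↦ ?_
  · rw [heval]
    exact hq _ (hmem i w hw)
  · rw [hderiv]
    exact mul_nonneg (hc i) (mul_nonneg (Real.exp_nonneg _) (hq' _ (hmem i w hw)))

/-- Polynomials which increase on `[0, 1]` and converge there to the indicator function of
`[1/2, 1]`. -/
noncomputable def stepPolynomial (m : ℕ) : ℝ[X] := 1 - (1 - X ^ m) ^ (m * 2 ^ m)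

lemma eval_stepPolynomial (m : ℕ) (y : ℝ) :
    (stepPolynomial m).eval y = 1 - (1 - y ^ m) ^ (m * 2 ^ m) := by
  simp [stepPolynomial]

lemma eval_stepPolynomial_mem_Icc (m : ℕ) {y : ℝ} (hy : y ∈ Set.Icc (0 : ℝ) 1) :
    (stepPolynomial m).eval y ∈ Set.Icc (0 : ℝ) 1 := by
  have h0 : 0 ≤ 1 - y ^ m := sub_nonneg.2 (pow_le_one₀ hy.1 hy.2)
  have h1 : 1 - y ^ m ≤ 1 := sub_le_self _ (pow_nonneg hy.1 m)
  rw [eval_stepPolynomial]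
  exact ⟨sub_nonneg.2 (pow_le_one₀ h0 h1), sub_le_self _ (pow_nonneg h0 _)⟩

lemma eval_derivative_stepPolynomial_nonneg (m : ℕ) {y : ℝ} (hy : y ∈ Set.Icc (0 : ℝ) 1) :
    0 ≤ (stepPolynomial m).derivative.eval y := by
  have h0 : 0 ≤ 1 - y ^ m := sub_nonneg.2 (pow_le_one₀ hy.1 hy.2)
  have hy0 := hy.1
  simp [stepPolynomial, Polynomial.derivative_pow]
  positivity

lemma tendsto_eval_stepPolynomial {y : ℝ} (hy : y ∈ Set.Icc (0 : ℝ) 1) :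
    Tendsto (fun m ↦ (stepPolynomial m).eval y) atTop (𝓝 (if 1 / 2 ≤ y then 1 else 0)) := by
  have h0 : ∀ m : ℕ, 0 ≤ 1 - y ^ m := fun m ↦ sub_nonneg.2 (pow_le_one₀ hy.1 hy.2)
  split_ifs with h
  · have hlim : Tendsto (fun m : ℕ ↦ 1 - Real.exp (-(m : ℝ))) atTop (𝓝 1) := by
      simpa using ((Real.tendsto_exp_neg_atTop_nhds_zero).comp
        tendsto_natCast_atTop_atTop).const_sub 1
    refine tendsto_of_tendsto_of_tendsto_of_le_of_le hlim tendsto_const_nhds (fun m ↦ ?_)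
      fun m ↦ (eval_stepPolynomial_mem_Icc m hy).2
    rw [eval_stepPolynomial]
    refine sub_le_sub_left ?_ 1
    have h1 : 1 - y ^ m ≤ Real.exp (-(1 / 2) ^ m) :=
      (sub_le_sub_left (pow_le_pow_left₀ (by norm_num) h m) 1).trans (Real.one_sub_le_exp_neg _)
    refine (pow_le_pow_left₀ (h0 m) h1 _).trans (le_of_eq ?_)
    rw [← Real.exp_nat_mul]
    congr 1
    push_cast
    rw [mul_neg, mul_assoc, ← mul_pow]
    norm_num
  · have hlim : Tendsto (fun m : ℕ ↦ (m : ℝ) * (2 * y) ^ m) atTop (𝓝 0) :=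
      tendsto_self_mul_const_pow_of_lt_one (by linarith [hy.1]) (by linarith)
    refine tendsto_of_tendsto_of_tendsto_of_le_of_le tendsto_const_nhds hlim
      (fun m ↦ (eval_stepPolynomial_mem_Icc m hy).1) fun m ↦ ?_
    simp only [eval_stepPolynomial]
    have h1 := one_add_mul_le_pow (a := -y ^ m) (by linarith [h0 m]) (m * 2 ^ m)
    rw [← sub_eq_add_neg] at h1
    push_cast at h1
    have h2 : (m : ℝ) * (2 * y) ^ m = m * 2 ^ m * y ^ m := by rw [mul_pow, mul_assoc]
    linarith

lemma half_le_exp_neg_iff {t : ℝ} (ht : 0 < t) (x : ℝ) :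
    1 / 2 ≤ Real.exp (-(2 * Real.log 2 / t ^ 2 * (x ^ 2 / 2))) ↔ |x| ≤ t := by
  have hlog : 0 < Real.log 2 := Real.log_pos one_lt_two
  rw [← Real.log_le_iff_le_exp (by norm_num), one_div, Real.log_inv, neg_le_neg_iff,
    ← sq_le_sq₀ (abs_nonneg x) ht.le, sq_abs]
  have h : 2 * Real.log 2 / t ^ 2 * (x ^ 2 / 2) = Real.log 2 * (x ^ 2 / t ^ 2) := by ring
  rw [h, mul_le_iff_le_one_right hlog, div_le_one (by positivity)]

omit [DecidableEq ι] in
lemma tendsto_integral_prod_stepPolynomial {Ω : Type*} [MeasurableSpace Ω] (ν : Measure Ω)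
    [IsProbabilityMeasure ν] {Y : Ω → ι → ℝ} (hY : Measurable Y) {t : ι → ℝ}
    (ht : ∀ i, 0 < t i) :
    Tendsto (fun m ↦ ∫ ω, ∏ i, (stepPolynomial m).eval
        (Real.exp (-(2 * Real.log 2 / t i ^ 2 * (Y ω i ^ 2 / 2)))) ∂ν)
      atTop (𝓝 (ν.real {ω | ∀ i, |Y ω i| ≤ t i})) := by
  have hlog : 0 < Real.log 2 := Real.log_pos one_lt_two
  have hmem : ∀ ω i, Real.exp (-(2 * Real.log 2 / t i ^ 2 * (Y ω i ^ 2 / 2))) ∈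
      Set.Icc (0 : ℝ) 1 := fun ω i ↦
    ⟨Real.exp_nonneg _, Real.exp_le_one_iff.2 (neg_nonpos.2 (by positivity))⟩
  have hset : MeasurableSet {ω | ∀ i, |Y ω i| ≤ t i} := by
    rw [Set.ofPred_forall]
    exact MeasurableSet.iInter fun i ↦ measurableSet_le (by fun_prop) (by fun_prop)
  rw [← integral_indicator_one hset]
  refine tendsto_integral_of_dominated_convergence (fun _ ↦ 1)
    (fun m ↦ Measurable.aestronglyMeasurable ?_) (integrable_const _)
    (fun m ↦ ae_of_all _ fun ω ↦ ?_) (ae_of_all _ fun ω ↦ ?_)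
  · simp only [eval_stepPolynomial]
    fun_prop
  · have h := fun i ↦ eval_stepPolynomial_mem_Icc m (hmem ω i)
    rw [Real.norm_of_nonneg (Finset.prod_nonneg fun i _ ↦ (h i).1)]
    exact Finset.prod_le_one (fun i _ ↦ (h i).1) fun i _ ↦ (h i).2
  · have h := tendsto_finsetProd Finset.univ fun i _ ↦ tendsto_eval_stepPolynomial (hmem ω i)
    simp only [half_le_exp_neg_iff (ht _)] at h
    convert h using 2
    rw [Finset.prod_ite_zero]
    simp [Set.indicator]

lemma HasGaussianSqLaplace.measure_mul_measure_le {μ : Measure (ι → ℝ)} [IsProbabilityMeasure μ]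
    {C : Matrix ι ι ℝ} (hC : C.PosSemidef) (hμ : HasGaussianSqLaplace μ C)
    (p : ι → Prop) {t : ι → ℝ} (ht : ∀ i, 0 < t i) :
    μ {x | ∀ i, p i → |x i| ≤ t i} * μ {x | ∀ i, ¬ p i → |x i| ≤ t i}
      ≤ μ {x | ∀ i, |x i| ≤ t i} := by
  classical
  have hlog : 0 < Real.log 2 := Real.log_pos one_lt_two
  have hmeas : Measurable (fun (x : (ι → ℝ) × (ι → ℝ)) i ↦ if p i then x.1 i else x.2 i) := by
    refine measurable_pi_lambda _ fun i ↦ ?_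
    split_ifs <;> fun_prop
  have hset : {x : (ι → ℝ) × (ι → ℝ) | ∀ i, |if p i then x.1 i else x.2 i| ≤ t i}
      = {x | ∀ i, p i → |x i| ≤ t i} ×ˢ {x | ∀ i, ¬ p i → |x i| ≤ t i} := by
    ext x
    simp only [Set.mem_ofPred_eq, Set.mem_prod, ← forall_and]
    refine forall_congr' fun i ↦ ?_
    by_cases hi : p i <;> simp [hi]
  have h := le_of_tendsto_of_tendsto'
    (tendsto_integral_prod_stepPolynomial (μ.prod μ) hmeas ht)
    (tendsto_integral_prod_stepPolynomial μ measurable_id ht)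
    fun m ↦ hμ.integral_prod_eval_le hC p (c := fun i ↦ 2 * Real.log 2 / t i ^ 2)
      (fun i ↦ by simp only [Pi.zero_apply]; positivity)
      (fun y hy ↦ (eval_stepPolynomial_mem_Icc m hy).1)
      fun y hy ↦ eval_derivative_stepPolynomial_nonneg m hy
  rw [hset] at h
  rw [← Measure.prod_prod]
  exact (ENNReal.toReal_le_toReal (measure_ne_top _ _) (measure_ne_top _ _)).1 h

end Limit

lemma IsCenteredGaussianVector.exists_map_eq {Ω : Type*} [MeasurableSpace Ω] {P : Measure Ω}
    [IsProbabilityMeasure P] {n : ℕ} {X : Ω → Fin n → ℝ} (hX : IsCenteredGaussianVector P X) :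
    ∃ S : Matrix (Fin n) (Fin n) ℝ, S.PosSemidef ∧
      P.map X = (multivariateGaussian 0 S).map WithLp.ofLp := by
  obtain ⟨hm, S, hS, hlaw⟩ := hX
  have hXm : Measurable X := measurable_pi_lambda _ hm
  refine ⟨S, hS, ?_⟩
  have key : P.map (fun ω ↦ WithLp.toLp 2 (X ω)) = multivariateGaussian 0 S := by
    have : IsProbabilityMeasure (P.map (fun ω ↦ WithLp.toLp 2 (X ω))) :=
      Measure.isProbabilityMeasure_map (Measurable.aemeasurable (by fun_prop))
    refine Measure.ext_of_charFun ?_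
    ext c
    have hvar : ∑ i, ∑ j, c i * S i j * c j = c.ofLp ⬝ᵥ S.mulVec c.ofLp := by
      simp only [dotProduct, Matrix.mulVec, Finset.mul_sum, mul_assoc]
    have hnn : 0 ≤ c.ofLp ⬝ᵥ S.mulVec c.ofLp := by
      simpa using hS.dotProduct_mulVec_nonneg c.ofLp
    have h1 := congrArg (fun ν ↦ charFun ν 1) (hlaw c.ofLp)
    simp only [hvar, charFun_gaussianReal] at h1
    rw [charFun_apply_real, integral_map (Measurable.aemeasurable (by fun_prop))
      (Measurable.aestronglyMeasurable (by fun_prop))] at h1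
    rw [charFun_multivariateGaussian hS, charFun_apply,
      integral_map (Measurable.aemeasurable (by fun_prop))
      (Measurable.aestronglyMeasurable (by fun_prop))]
    convert h1 using 1
    · simp [PiLp.inner_apply]
    · simp [hnn]
  rw [← key, Measure.map_map (by fun_prop) (by fun_prop)]
  rfl

end GaussianCorrelation

/-- The Gaussian correlation inequality (Lemma 2.4): for a centered Gaussian
vector `X` in `ℝ^{n₁+n₂}` and positive thresholds `t_i`,
`P(|X_i| ≤ t_i, i ≤ n₁+n₂) ≥ P(|X_i| ≤ t_i, i ≤ n₁) · P(|X_i| ≤ t_i, n₁ < i)`. -/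
theorem gaussian_correlation_inequality
    {Ω : Type*} [MeasurableSpace Ω] (P : Measure Ω) [IsProbabilityMeasure P]
    (n₁ n₂ : ℕ) (X : Ω → Fin (n₁ + n₂) → ℝ)
    (hX : IsCenteredGaussianVector P X)
    (t : Fin (n₁ + n₂) → ℝ) (ht : ∀ i, 0 < t i) :
    P {ω | ∀ i : Fin (n₁ + n₂), (i : ℕ) < n₁ → |X ω i| ≤ t i} *
      P {ω | ∀ i : Fin (n₁ + n₂), n₁ ≤ (i : ℕ) → |X ω i| ≤ t i}
      ≤ P {ω | ∀ i, |X ω i| ≤ t i} := by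
  obtain ⟨S, hS, hmap⟩ := hX.exists_map_eq
  have hXm : Measurable X := measurable_pi_lambda _ hX.1
  have : IsProbabilityMeasure (P.map X) := Measure.isProbabilityMeasure_map hXm.aemeasurable
  have hL : HasGaussianSqLaplace (P.map X) S := by
    rw [hmap]
    exact hasGaussianSqLaplace_multivariateGaussian hS
  have hset : ∀ q : Fin (n₁ + n₂) → Prop,
      MeasurableSet {x : Fin (n₁ + n₂) → ℝ | ∀ i, q i → |x i| ≤ t i} := fun q ↦ by
    simp only [Set.ofPred_forall]
    exact MeasurableSet.iInter fun i ↦ MeasurableSet.iInter fun _ ↦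
      measurableSet_le (by fun_prop) (by fun_prop)
  have h := hL.measure_mul_measure_le hS (fun i ↦ (i : ℕ) < n₁) ht
  simp only [not_lt] at h
  rw [Measure.map_apply hXm (hset _), Measure.map_apply hXm (hset _),
    Measure.map_apply hXm (by simpa using hset fun _ ↦ True)] at h
  exact h
end

section
/- Mean square stability characterization of the fractional linear test equation: Let H ∈ (1/2,1), κ ≥ 2H and λ, μ ∈ ℝ. Then lim_{t→∞} exp(2(−λ t^κ + μ² t^{2H})) = 0 holds if and only if either (κ > 2H and λ > 0) or (κ = 2H and −λ + μ² < 0); otherwise the function exp(2(−λ t^κ + μ² t^{2H})) does not tend to 0 as t → ∞. -/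
open Filter Real

/-- If `b < a` and `0 < c`, the leading term of `-c t ^ a + d t ^ b` dominates. -/
theorem tendsto_neg_mul_rpow_add_mul_rpow_atBot {a b c : ℝ} (d : ℝ) (hb : 0 < b) (hab : b < a)
    (hc : 0 < c) : Tendsto (fun t : ℝ => -c * t ^ a + d * t ^ b) atTop atBot := by
  have hlead : Tendsto (fun t : ℝ => -c * t ^ (a - b) + d) atTop atBot :=
    tendsto_atBot_add_const_right _ _
      ((tendsto_rpow_atTop (sub_pos.2 hab)).const_mul_atTop_of_neg (neg_neg_of_pos hc))
  refine ((tendsto_rpow_atTop hb).atTop_mul_atBot₀ hlead).congr' ?_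
  filter_upwards [eventually_gt_atTop 0] with t ht
  rw [show t ^ a = t ^ b * t ^ (a - b) by rw [← rpow_add ht, add_sub_cancel]]
  ring

/-- Mean square stability characterization of the fractional linear test equation
(condition (1.8)): for `H ∈ (1/2,1)` and `κ ≥ 2H`,
`exp(2(−λ t^κ + μ² t^{2H})) → 0` as `t → ∞` if and only if either
(`κ > 2H` and `λ > 0`) or (`κ = 2H` and `−λ + μ² < 0`). -/
theorem fractional_test_equation_stability_iff (H κ lam μ : ℝ)
    (hH : H ∈ Set.Ioo (1 / 2 : ℝ) 1) (hκ : 2 * H ≤ κ) :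
    Tendsto (fun t : ℝ => Real.exp (2 * (-lam * t ^ κ + μ ^ 2 * t ^ (2 * H))))
        atTop (nhds 0)
      ↔ ((2 * H < κ ∧ 0 < lam) ∨ (κ = 2 * H ∧ -lam + μ ^ 2 < 0)) := by
  have hH0 : 0 < 2 * H := by linarith [hH.1]
  rw [tendsto_exp_comp_nhds_zero, tendsto_const_mul_atBot_of_pos two_pos]
  constructor
  · intro h
    obtain ⟨t, hneg, ht⟩ := ((h.eventually_lt_atBot 0).and (eventually_gt_atTop 0)).exists
    have hκt : 0 < t ^ κ := rpow_pos_of_pos ht κ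
    have hHt : 0 < t ^ (2 * H) := rpow_pos_of_pos ht _
    rcases hκ.lt_or_eq with hlt | rfl
    · refine Or.inl ⟨hlt, pos_of_mul_pos_left ?_ hκt.le⟩
      linarith [mul_nonneg (sq_nonneg μ) hHt.le]
    · refine Or.inr ⟨rfl, neg_of_mul_neg_left ?_ hHt.le⟩
      linarith
  · rintro (⟨hlt, hlam⟩ | ⟨rfl, hneg⟩)
    · exact tendsto_neg_mul_rpow_add_mul_rpow_atBot _ hH0 hlt hlam
    · simp_rw [← add_mul]
      exact (tendsto_rpow_atTop hH0).const_mul_atTop_of_neg hneg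
end
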